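/- arXiv:2507.05059 — 3 statements merged into one kernel-verified Lean document; each statement's English description precedes it below -/
import Mathlib

section
/- Let μ > 1 and n ∈ ℤ. Suppose v : (0,∞) → ℂ is smooth and bounded and satisfies, for all β > 0, (D_β − |n|μ − 2μ + 1)(D_β + |n|μ − 2μ + 1)(D_β + 1 + inβ)v + (2μ−1)inβ v = 0, where D_β w(β) = βw'(β) and the displayed expression is the composition of the three first-order operators applied to v. Then v ≡ 0. -/
open Filter Topology Set

/-- `D_β w (β) = β w'(β)`. -/
noncomputable def Dop (w : ℝ → ℂ) (β : ℝ) : ℂ := (β : ℂ) * deriv w β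

/-- `f = O(exp (r x))` on the half-line `[0, ∞)`. -/
def ExpBdd (r : ℝ) (f : ℝ → ℂ) : Prop :=
  ∃ C : ℝ, ∀ x : ℝ, 0 ≤ x → ‖f x‖ ≤ C * Real.exp (r * x)

/-- `f = O(exp (r x))` on the half-line `(-∞, 0]`. -/
def ExpBddBot (r : ℝ) (f : ℝ → ℂ) : Prop := ExpBdd (-r) fun x => f (-x)

namespace ExpBdd

variable {r s l q : ℝ} {f g : ℝ → ℂ}

theorem exists_nonneg (h : ExpBdd r f) :
    ∃ C : ℝ, 0 ≤ C ∧ ∀ x : ℝ, 0 ≤ x → ‖f x‖ ≤ C * Real.exp (r * x) := by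
  obtain ⟨C, hC⟩ := h
  refine ⟨C, ?_, hC⟩
  simpa using (norm_nonneg _).trans (hC 0 le_rfl)

theorem mono (h : ExpBdd r f) (hrs : r ≤ s) : ExpBdd s f := by
  obtain ⟨C, hC0, hC⟩ := h.exists_nonneg
  exact ⟨C, fun x hx => (hC x hx).trans (by gcongr)⟩

theorem add (hf : ExpBdd r f) (hg : ExpBdd r g) : ExpBdd r fun x => f x + g x := by
  obtain ⟨C, hC⟩ := hf
  obtain ⟨D, hD⟩ := hg
  refine ⟨C + D, fun x hx => (norm_add_le _ _).trans ?_⟩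
  linarith [hC x hx, hD x hx]

theorem const_mul (a : ℂ) (hf : ExpBdd r f) : ExpBdd r fun x => a * f x := by
  obtain ⟨C, hC⟩ := hf
  refine ⟨‖a‖ * C, fun x hx => ?_⟩
  rw [norm_mul, mul_assoc]
  exact mul_le_mul_of_nonneg_left (hC x hx) (norm_nonneg _)

theorem neg (hf : ExpBdd r f) : ExpBdd r fun x => -f x := by
  simpa using hf.const_mul (-1)

theorem sub (hf : ExpBdd r f) (hg : ExpBdd r g) : ExpBdd r fun x => f x - g x := by
  simpa [sub_eq_add_neg] using hf.add hg.neg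

theorem exp_mul (s : ℝ) (hf : ExpBdd r f) :
    ExpBdd (s + r) fun x => (Real.exp (s * x) : ℂ) * f x := by
  obtain ⟨C, hC⟩ := hf
  refine ⟨C, fun x hx => ?_⟩
  rw [norm_mul, Complex.norm_real, Real.norm_of_nonneg (Real.exp_pos _).le, add_mul, Real.exp_add]
  nlinarith [hC x hx, Real.exp_pos (s * x)]

theorem eq_zero_of_lt {A : ℂ} (hql : q < l)
    (h : ExpBdd q fun x => A * (Real.exp (l * x) : ℂ)) : A = 0 := by
  obtain ⟨C, hC⟩ := h
  have hlim : Tendsto (fun x : ℝ => C * Real.exp (-((l - q) * x))) atTop (𝓝 (C * 0)) :=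
    (Real.tendsto_exp_neg_atTop_nhds_zero.comp
      (tendsto_id.const_mul_atTop (sub_pos.2 hql))).const_mul C
  rw [mul_zero] at hlim
  have : ‖A‖ ≤ 0 := by
    refine ge_of_tendsto hlim ?_
    filter_upwards [eventually_ge_atTop 0] with x hx
    have h1 := hC x hx
    rw [norm_mul, Complex.norm_real, Real.norm_of_nonneg (Real.exp_pos _).le] at h1
    have h2 : Real.exp (q * x) = Real.exp (-((l - q) * x)) * Real.exp (l * x) := by
      rw [← Real.exp_add]; ring_nf
    rw [h2, ← mul_assoc] at h1
    exact le_of_mul_le_mul_right h1 (Real.exp_pos _)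
  simpa using this

/-- The increment bound behind all growth estimates. -/
theorem norm_sub_le {f' : ℝ → ℂ} {C s : ℝ} (hs : s ≠ 0) (hf : ∀ x, HasDerivAt f (f' x) x)
    (hC : ∀ x, 0 ≤ x → ‖f' x‖ ≤ C * Real.exp (s * x)) {x y : ℝ} (hx : 0 ≤ x) (hxy : x ≤ y) :
    ‖f y - f x‖ ≤ C / s * (Real.exp (s * y) - Real.exp (s * x)) := by
  have hB : ∀ t : ℝ, HasDerivAt (fun t => C / s * (Real.exp (s * t) - Real.exp (s * x)))
      (C * Real.exp (s * t)) t := by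
    intro t
    have h := ((((hasDerivAt_id t).const_mul s).exp).sub_const (Real.exp (s * x))).const_mul (C / s)
    refine h.congr_deriv ?_
    simp only [id]
    field_simp
  refine image_norm_le_of_norm_deriv_right_le_deriv_boundary
    (f := fun t => f t - f x) (f' := f') (a := x) (b := y) ?_ ?_ ?_ hB ?_ ⟨hxy, le_rfl⟩
  · exact fun t _ => ((hf t).sub_const _).continuousAt.continuousWithinAt
  · exact fun t _ => ((hf t).sub_const _).hasDerivWithinAt
  · simp
  · exact fun t ht => hC t (hx.trans ht.1)

theorem hasDerivAt_exp_neg_mul (hf : ∀ x, HasDerivAt f (l * f x + g x) x) (x : ℝ) :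
    HasDerivAt (fun x => (Real.exp (-l * x) : ℂ) * f x) ((Real.exp (-l * x) : ℂ) * g x) x := by
  have h := ((((hasDerivAt_id x).const_mul (-l)).exp).ofReal_comp).mul (hf x)
  refine h.congr_deriv ?_
  simp only [id]
  push_cast
  ring

theorem of_deriv_of_lt (hf : ∀ x, HasDerivAt f (l * f x + g x) x) (hlr : l < r)
    (hg : ExpBdd r g) : ExpBdd r f := by
  obtain ⟨C, hC0, hC⟩ := (hg.exp_mul (-l)).exists_nonneg
  have hs : 0 < -l + r := by linarith
  have key : ExpBdd (-l + r) fun x => (Real.exp (-l * x) : ℂ) * f x := by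
    refine ⟨‖f 0‖ + C / (-l + r), fun x hx => ?_⟩
    have h := norm_sub_le hs.ne' (hasDerivAt_exp_neg_mul hf) hC le_rfl hx
    have h2 := norm_le_norm_add_norm_sub ((Real.exp (-l * 0) : ℂ) * f 0)
      ((Real.exp (-l * x) : ℂ) * f x)
    simp only [mul_zero, Real.exp_zero, Complex.ofReal_one, one_mul] at h h2
    have h3 : 1 ≤ Real.exp ((-l + r) * x) := Real.one_le_exp (by positivity)
    have h4 : 0 ≤ C / (-l + r) := by positivity
    rw [norm_sub_rev] at h2
    change ‖(Real.exp (-l * x) : ℂ) * f x‖ ≤ _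
    rw [norm_sub_rev] at h
    rw [norm_sub_rev] at h2
    nlinarith [norm_nonneg (f 0), mul_le_mul_of_nonneg_left h3 (norm_nonneg (f 0))]
  have := key.exp_mul l
  convert this using 1
  · ring
  · funext x
    rw [← mul_assoc, ← Complex.ofReal_mul, ← Real.exp_add]
    simp

theorem exists_sub_exp (hf : ∀ x, HasDerivAt f (l * f x + g x) x) (hrl : r < l)
    (hg : ExpBdd r g) : ∃ A : ℂ, ExpBdd r fun x => f x - A * (Real.exp (l * x) : ℂ) := by
  obtain ⟨C, hC0, hC⟩ := (hg.exp_mul (-l)).exists_nonneg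
  have hs : -l + r < 0 := by linarith
  set φ : ℝ → ℂ := fun x => (Real.exp (-l * x) : ℂ) * f x with hφ
  have hd : 0 ≤ C / (-(-l + r)) := div_nonneg hC0 (by linarith)
  have hinc : ∀ x y, 0 ≤ x → x ≤ y → ‖φ y - φ x‖ ≤ C / (-(-l + r)) * Real.exp ((-l + r) * x) := by
    intro x y hx hxy
    refine (norm_sub_le hs.ne (hasDerivAt_exp_neg_mul hf) hC hx hxy).trans ?_
    have : C / (-l + r) = -(C / (-(-l + r))) := by rw [div_neg, neg_neg]
    rw [this]
    nlinarith [Real.exp_pos ((-l + r) * y)]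
  have hlim : Tendsto (fun x : ℝ => C / (-(-l + r)) * Real.exp ((-l + r) * x)) atTop (𝓝 0) := by
    have h := (Real.tendsto_exp_neg_atTop_nhds_zero.comp
      (tendsto_id.const_mul_atTop (neg_pos.2 hs))).const_mul (C / (-(-l + r)))
    rw [mul_zero] at h
    refine h.congr fun x => ?_
    simp only [Function.comp_apply, id, neg_mul, neg_neg]
  have hcau : CauchySeq φ := by
    refine Metric.cauchySeq_iff'.2 fun ε hε => ?_
    obtain ⟨N, hN, hN0⟩ := ((hlim.eventually_lt_const hε).and (eventually_ge_atTop 0)).exists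
    exact ⟨N, fun n hn => by rw [dist_eq_norm]; exact (hinc N n hN0 hn).trans_lt hN⟩
  obtain ⟨A, hA⟩ := cauchySeq_tendsto_of_complete hcau
  have key : ExpBdd (-l + r) fun x => φ x - A := by
    refine ⟨C / (-(-l + r)), fun x hx => ?_⟩
    have h1 : Tendsto (fun y => ‖φ x - φ y‖) atTop (𝓝 ‖φ x - A‖) := (hA.const_sub _).norm
    refine le_of_tendsto h1 ?_
    filter_upwards [eventually_ge_atTop x] with y hy
    rw [norm_sub_rev]
    exact hinc x y hx hy
  refine ⟨A, ?_⟩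
  have := key.exp_mul l
  convert this using 1
  · ring
  · funext x
    rw [hφ, mul_sub, ← mul_assoc, ← Complex.ofReal_mul, ← Real.exp_add]
    simp [mul_comm]

theorem const_mul_exp (A : ℂ) (hlr : l ≤ r) :
    ExpBdd r fun x => A * (Real.exp (l * x) : ℂ) := by
  refine ExpBdd.mono (r := l) ⟨‖A‖, fun x _ => ?_⟩ hlr
  rw [norm_mul, Complex.norm_real, Real.norm_of_nonneg (Real.exp_pos _).le]

theorem of_deriv_of_gt (hf : ∀ x, HasDerivAt f (l * f x + g x) x) (hrl : r < l) (hql : q < l)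
    (hg : ExpBdd r g) (hfq : ExpBdd q f) : ExpBdd r f := by
  obtain ⟨A, hA⟩ := exists_sub_exp hf hrl hg
  have h : ExpBdd (max q r) fun x => A * (Real.exp (l * x) : ℂ) := by
    simpa using (hfq.mono (le_max_left q r)).sub (hA.mono (le_max_right q r))
  have hA0 := eq_zero_of_lt (max_lt hql hrl) h
  simpa [hA0] using hA

theorem slope_eq_zero {K : ℂ} (hf : ∀ x, HasDerivAt f (K + g x) x) (hr : r < 0)
    (hg : ExpBdd r g) (hf0 : ExpBdd 0 f) : K = 0 := by
  have h1 : ∀ x, HasDerivAt (fun x : ℝ => f x - K * (x : ℂ))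
      (((0 : ℝ) : ℂ) * (f x - K * (x : ℂ)) + g x) x := by
    intro x
    have h := (hf x).sub (((hasDerivAt_id x).ofReal_comp).const_mul K)
    refine h.congr_deriv ?_
    push_cast
    ring
  obtain ⟨A, hA⟩ := exists_sub_exp h1 hr hg
  have h2 : ExpBdd 0 fun x => K * (x : ℂ) := by
    have := (hf0.sub (hA.mono hr.le)).sub (const_mul_exp A (le_refl (0 : ℝ)))
    refine (congrArg (ExpBdd 0) (funext fun x => ?_)).mp this
    simp only [zero_mul, Real.exp_zero, Complex.ofReal_one]
    ring
  obtain ⟨C, hC0, hC⟩ := h2.exists_nonneg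
  by_contra hK
  have hK' : 0 < ‖K‖ := norm_pos_iff.2 hK
  have h3 := hC ((C + 1) / ‖K‖) (by positivity)
  rw [norm_mul, Complex.norm_real, Real.norm_of_nonneg (by positivity),
    mul_div_cancel₀ _ hK'.ne'] at h3
  simp at h3
  linarith

end ExpBdd

theorem hasDerivAt_comp_neg' {f g : ℝ → ℂ} {l : ℝ} (hf : ∀ x, HasDerivAt f (l * f x + g x) x)
    (x : ℝ) : HasDerivAt (fun x => f (-x)) ((-l : ℝ) * f (-x) + -g (-x)) x := by
  have h := (hf (-x)).scomp x (hasDerivAt_neg x)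
  refine h.congr_deriv ?_
  rw [neg_one_smul]
  push_cast
  ring

namespace ExpBddBot

variable {r s l q : ℝ} {f g : ℝ → ℂ}

theorem mono (h : ExpBddBot r f) (hsr : s ≤ r) : ExpBddBot s f :=
  ExpBdd.mono h (neg_le_neg hsr)

theorem add (hf : ExpBddBot r f) (hg : ExpBddBot r g) : ExpBddBot r fun x => f x + g x :=
  ExpBdd.add hf hg

theorem sub (hf : ExpBddBot r f) (hg : ExpBddBot r g) : ExpBddBot r fun x => f x - g x :=
  ExpBdd.sub hf hg

theorem const_mul (a : ℂ) (hf : ExpBddBot r f) : ExpBddBot r fun x => a * f x :=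
  ExpBdd.const_mul a hf

theorem exp_mul (s : ℝ) (hf : ExpBddBot r f) :
    ExpBddBot (s + r) fun x => (Real.exp (s * x) : ℂ) * f x := by
  have h := ExpBdd.exp_mul (-s) hf
  unfold ExpBddBot
  convert h using 1
  · ring
  · funext x; simp

theorem exists_le (h : ExpBddBot r f) :
    ∃ C : ℝ, 0 ≤ C ∧ ∀ x : ℝ, x ≤ 0 → ‖f x‖ ≤ C * Real.exp (r * x) := by
  obtain ⟨C, hC0, hC⟩ := ExpBdd.exists_nonneg h
  refine ⟨C, hC0, fun x hx => ?_⟩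
  simpa using hC (-x) (by linarith)

theorem of_deriv_of_lt (hf : ∀ x, HasDerivAt f (l * f x + g x) x) (hrl : r < l)
    (hg : ExpBddBot r g) : ExpBddBot r f :=
  ExpBdd.of_deriv_of_lt (hasDerivAt_comp_neg' hf) (neg_lt_neg hrl) (ExpBdd.neg hg)

theorem exists_sub_exp (hf : ∀ x, HasDerivAt f (l * f x + g x) x) (hlr : l < r)
    (hg : ExpBddBot r g) : ∃ A : ℂ, ExpBddBot r fun x => f x - A * (Real.exp (l * x) : ℂ) := by
  obtain ⟨A, hA⟩ :=
    ExpBdd.exists_sub_exp (hasDerivAt_comp_neg' hf) (neg_lt_neg hlr) (ExpBdd.neg hg)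
  exact ⟨A, by simpa [ExpBddBot] using hA⟩

theorem of_deriv_of_gt (hf : ∀ x, HasDerivAt f (l * f x + g x) x) (hlr : l < r) (hlq : l < q)
    (hg : ExpBddBot r g) (hfq : ExpBddBot q f) : ExpBddBot r f :=
  ExpBdd.of_deriv_of_gt (hasDerivAt_comp_neg' hf) (neg_lt_neg hlr) (neg_lt_neg hlq)
    (ExpBdd.neg hg) hfq

theorem slope_eq_zero {K : ℂ} (hf : ∀ x, HasDerivAt f (K + g x) x) (hr : 0 < r)
    (hg : ExpBddBot r g) (hf0 : ExpBddBot 0 f) : K = 0 := by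
  have h1 : ∀ x, HasDerivAt (fun x => f (-x)) (-K + -g (-x)) x := by
    intro x
    have h := (hf (-x)).scomp x (hasDerivAt_neg x)
    refine h.congr_deriv ?_
    rw [neg_one_smul]
    ring
  have h2 := ExpBdd.slope_eq_zero h1 (neg_lt_zero.2 hr) (ExpBdd.neg hg)
    (by simpa [ExpBddBot] using hf0)
  simpa using h2

end ExpBddBot

/-- A nondecreasing function with nonpositive limit superior at `∞` and limit `0` at `-∞` is
constant. -/
theorem deriv_eq_zero_of_squeeze {E E' : ℝ → ℝ} {C D s t : ℝ} (hE : ∀ x, HasDerivAt E (E' x) x)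
    (hE' : ∀ x, 0 ≤ E' x) (hs : s < 0) (ht : 0 < t)
    (htop : ∀ x, 0 ≤ x → E x ≤ C * Real.exp (s * x))
    (hbot : ∀ x, x ≤ 0 → |E x| ≤ D * Real.exp (t * x)) (x : ℝ) : E' x = 0 := by
  have hmono : Monotone E := monotone_of_hasDerivAt_nonneg hE hE'
  have h1 : Tendsto (fun x => C * Real.exp (s * x)) atTop (𝓝 0) := by
    simpa using (Real.tendsto_exp_atBot.comp
      (tendsto_id.const_mul_atTop_of_neg hs)).const_mul C
  have h2 : Tendsto (fun x => -(D * Real.exp (t * x))) atBot (𝓝 0) := by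
    simpa using ((Real.tendsto_exp_atBot.comp
      (tendsto_id.const_mul_atBot ht)).const_mul D).neg
  have hz : E = fun _ => 0 := by
    funext y
    refine le_antisymm (ge_of_tendsto h1 ?_) (le_of_tendsto h2 ?_)
    · filter_upwards [eventually_ge_atTop (max 0 y)] with z hz
      exact (hmono ((le_max_right _ _).trans hz)).trans (htop z ((le_max_left _ _).trans hz))
    · filter_upwards [eventually_le_atBot (min 0 y)] with z hz
      have := hbot z (hz.trans (min_le_left _ _))
      exact (neg_le_of_abs_le this).trans (hmono (hz.trans (min_le_right _ _)))
  have h := hE x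
  rw [hz] at h
  exact h.unique (hasDerivAt_const x 0)

theorem eq_exp_of_deriv {f : ℝ → ℂ} {l : ℝ} (hf : ∀ x, HasDerivAt f (l * f x) x) (x : ℝ) :
    f x = f 0 * (Real.exp (l * x) : ℂ) := by
  have h : ∀ x, HasDerivAt (fun x => (Real.exp (-l * x) : ℂ) * f x) 0 x := fun x => by
    simpa using ExpBdd.hasDerivAt_exp_neg_mul (g := fun _ => 0) (by simpa using hf) x
  have h1 := is_const_of_deriv_eq_zero (fun x => (h x).differentiableAt) (fun x => (h x).deriv) x 0
  rw [mul_zero, Real.exp_zero, Complex.ofReal_one, one_mul] at h1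
  rw [← h1, mul_comm, ← mul_assoc, ← Complex.ofReal_mul, ← Real.exp_add]
  simp

theorem eq_zero_of_deriv_of_expBdd {f : ℝ → ℂ} {l q : ℝ} (hf : ∀ x, HasDerivAt f (l * f x) x)
    (hql : q < l) (hq : ExpBdd q f) (x : ℝ) : f x = 0 := by
  have h : f = fun x => f 0 * (Real.exp (l * x) : ℂ) := funext (eq_exp_of_deriv hf)
  rw [h] at hq
  rw [eq_exp_of_deriv hf, ExpBdd.eq_zero_of_lt hql hq, zero_mul]

theorem eq_zero_of_deriv_of_expBddBot {f : ℝ → ℂ} {l q : ℝ}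
    (hf : ∀ x, HasDerivAt f (l * f x) x) (hlq : l < q) (hq : ExpBddBot q f) (x : ℝ) : f x = 0 := by
  have h := hasDerivAt_comp_neg' (g := fun _ => 0) (by simpa using hf)
  simpa using eq_zero_of_deriv_of_expBdd (l := -l) (by simpa using h) (neg_lt_neg hlq) hq (-x)

/-- The first-order system in the logarithmic variable `x = log β` equivalent to
`(D - a - c)(D + a - c)(D + 1 + iNβ) V + c iNβ V = 0`, together with boundedness of `V`. -/
structure IsBoundedModeSystem (a c N : ℝ) (V W Z : ℝ → ℂ) : Prop where
  deriv_V : ∀ x, HasDerivAt V (W x - V x - Complex.I * N * (Real.exp x : ℂ) * V x) x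
  deriv_W : ∀ x, HasDerivAt W ((c - a : ℝ) * W x + Z x) x
  deriv_Z : ∀ x, HasDerivAt Z ((a + c : ℝ) * Z x
    + -(c * (Complex.I * N * (Real.exp x : ℂ) * V x))) x
  bdd : ∃ M : ℝ, ∀ x, ‖V x‖ ≤ M

namespace IsBoundedModeSystem

variable {a c N : ℝ} {V W Z : ℝ → ℂ}

theorem expBdd_V (h : IsBoundedModeSystem a c N V W Z) : ExpBdd 0 V := by
  obtain ⟨M, hM⟩ := h.bdd
  exact ⟨M, fun x _ => by simpa using hM x⟩

theorem expBddBot_V (h : IsBoundedModeSystem a c N V W Z) : ExpBddBot 0 V := by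
  obtain ⟨M, hM⟩ := h.bdd
  exact ⟨M, fun x _ => by simpa using hM (-x)⟩

theorem _root_.ExpBdd.forcing {r : ℝ} {f : ℝ → ℂ} (hf : ExpBdd r f) (N : ℝ) :
    ExpBdd (r + 1) fun x => Complex.I * N * (Real.exp x : ℂ) * f x := by
  have := (hf.exp_mul 1).const_mul (Complex.I * N)
  rw [add_comm]
  simpa [mul_assoc] using this

theorem _root_.ExpBddBot.forcing {r : ℝ} {f : ℝ → ℂ} (hf : ExpBddBot r f) (N : ℝ) :
    ExpBddBot (r + 1) fun x => Complex.I * N * (Real.exp x : ℂ) * f x := by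
  have := (hf.exp_mul 1).const_mul (Complex.I * N)
  rw [add_comm]
  simpa [mul_assoc] using this

theorem deriv_S (h : IsBoundedModeSystem a c N V W Z) (x : ℝ) :
    HasDerivAt (fun x => W x - (1 + c - a : ℝ) * V x)
      ((-1 : ℝ) * (W x - (1 + c - a : ℝ) * V x) +
        (Z x + (1 + c - a : ℝ) * (Complex.I * N * (Real.exp x : ℂ) * V x))) x := by
  refine ((h.deriv_W x).sub ((h.deriv_V x).const_mul _)).congr_deriv ?_
  push_cast
  ring

theorem deriv_exp_mul_V (h : IsBoundedModeSystem a c N V W Z) (l x : ℝ) :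
    HasDerivAt (fun x => (Real.exp (l * x) : ℂ) * V x)
      ((l + c - a : ℝ) * ((Real.exp (l * x) : ℂ) * V x) +
        ((Real.exp (l * x) : ℂ) * (W x - (1 + c - a : ℝ) * V x) -
        (Real.exp (l * x) : ℂ) * (Complex.I * N * (Real.exp x : ℂ) * V x))) x := by
  refine (((((hasDerivAt_id x).const_mul l).exp).ofReal_comp).mul (h.deriv_V x)).congr_deriv ?_
  simp only [id]
  push_cast
  ring

theorem expBddBot_Z (h : IsBoundedModeSystem a c N V W Z) (ha : 0 ≤ a) (hc : 1 < c) :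
    ExpBddBot 1 Z := by
  refine ExpBddBot.of_deriv_of_lt (l := a + c) h.deriv_Z (by linarith) ?_
  simpa using (h.expBddBot_V.forcing N).const_mul (-(c : ℂ))

theorem expBddBot_S (h : IsBoundedModeSystem a c N V W Z) (ha : 0 ≤ a) (hc : 1 < c) :
    ExpBddBot 1 fun x => W x - (1 + c - a : ℝ) * V x := by
  have hg : ExpBddBot 1 fun x => Complex.I * N * (Real.exp x : ℂ) * V x := by
    simpa using h.expBddBot_V.forcing N
  obtain ⟨K, hK⟩ := ExpBddBot.exists_sub_exp h.deriv_S (by norm_num)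
    ((h.expBddBot_Z ha hc).add (hg.const_mul _))
  have hk : ExpBddBot 1 fun x => (Real.exp (1 * x) : ℂ) * V x := by
    simpa using h.expBddBot_V.exp_mul 1
  have hK0 : K = 0 := by
    refine ExpBddBot.slope_eq_zero (r := 1) (f := fun x => (Real.exp (1 * x) : ℂ) * V x)
      (fun x => (h.deriv_exp_mul_V 1 x).congr_deriv ?_) one_pos
      ((hk.const_mul (1 + c - a : ℝ)).add
        (((hK.exp_mul 1).sub (hg.exp_mul 1)).mono (by norm_num))) (hk.mono zero_le_one)
    have he : (Real.exp (1 * x) : ℂ) * (Real.exp (-1 * x) : ℂ) = 1 := by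
      rw [← Complex.ofReal_mul, ← Real.exp_add]; simp
    linear_combination K * he
  simpa [hK0] using hK

theorem expBdd_Z (h : IsBoundedModeSystem a c N V W Z) (ha : 0 ≤ a) (hc : 1 < c) :
    ExpBdd 1 Z := by
  have hg : ExpBdd 1 fun x => Complex.I * N * (Real.exp x : ℂ) * V x := by
    simpa using h.expBdd_V.forcing N
  obtain ⟨A, hA⟩ := ExpBdd.exists_sub_exp (r := 1) h.deriv_Z (by linarith)
    (by simpa using hg.const_mul (-(c : ℂ)))
  have hl : ((a + c : ℝ) : ℂ) + 1 ≠ 0 := by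
    rw [← Complex.ofReal_one, ← Complex.ofReal_add, Complex.ofReal_ne_zero]
    linarith
  set K : ℂ := A / ((a + c : ℝ) + 1) with hKdef
  have hKA : K * ((a + c : ℝ) + 1) = A := div_mul_cancel₀ _ hl
  have hS : ExpBdd 1 fun x => (W x - (1 + c - a : ℝ) * V x)
      - K * (Real.exp ((a + c) * x) : ℂ) := by
    refine ExpBdd.of_deriv_of_lt (l := -1) (fun x => ?_) (by norm_num)
      (hA.add (hg.const_mul (1 + c - a : ℝ)))
    refine ((h.deriv_S x).sub
      ((((hasDerivAt_id x).const_mul (a + c)).exp.ofReal_comp).const_mul K)).congr_deriv ?_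
    simp only [id, mul_one]
    rw [← hKA]
    push_cast
    ring
  have hk : ExpBdd (-(a + c)) fun x => (Real.exp (-(a + c) * x) : ℂ) * V x := by
    simpa using h.expBdd_V.exp_mul (-(a + c))
  have hK0 : K = 0 := by
    refine ExpBdd.slope_eq_zero (r := -(a + c) + 1)
      (f := fun x => (Real.exp (-(a + c) * x) : ℂ) * V x)
      (fun x => (h.deriv_exp_mul_V (-(a + c)) x).congr_deriv ?_) (by linarith)
      (((hk.mono (by linarith)).const_mul (-(a + c) + c - a : ℝ)).add
        ((hS.exp_mul (-(a + c))).sub (hg.exp_mul (-(a + c))))) (hk.mono (by linarith))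
    have he : (Real.exp (-(a + c) * x) : ℂ) * (Real.exp ((a + c) * x) : ℂ) = 1 := by
      rw [← Complex.ofReal_mul, ← Real.exp_add, neg_mul, neg_add_cancel]; simp
    linear_combination K * he
  have hA0 : A = 0 := by rw [← hKA, hK0, zero_mul]
  simpa [hA0] using hA

theorem eq_zero_of_N_eq_zero (h : IsBoundedModeSystem 0 c 0 V W Z) (hc : 1 < c) (x : ℝ) :
    V x = 0 := by
  have hZ : ∀ x, Z x = 0 := eq_zero_of_deriv_of_expBdd (l := c)
    (fun x => (h.deriv_Z x).congr_deriv (by simp)) hc (h.expBdd_Z le_rfl hc)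
  have hS := eq_zero_of_deriv_of_expBddBot (l := -1)
    (fun x => (h.deriv_S x).congr_deriv (by simp [hZ])) (by norm_num) (h.expBddBot_S le_rfl hc)
  refine eq_zero_of_deriv_of_expBdd (l := c) (fun x => (h.deriv_V x).congr_deriv ?_)
    (by linarith) h.expBdd_V x
  have := hS x
  push_cast at this ⊢
  linear_combination this

end IsBoundedModeSystem

theorem bootstrap {P : ℝ → Prop} {L : ℝ} (base : ∀ s ≤ 0, P s)
    (step : ∀ s, -1 < s → s + 1 < L → P s → P (s + 1)) {t : ℝ} (ht : t < L) : P t := by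
  have key : ∀ k : ℕ, ∀ t < L, t ≤ k → P t := by
    intro k
    induction k with
    | zero => exact fun t _ h => base t (by simpa using h)
    | succ k ih =>
      intro t htL htk
      rcases le_or_gt t 0 with h0 | h0
      · exact base t h0
      · have := step (t - 1) (by linarith) (by linarith)
          (ih (t - 1) (by linarith) (by push_cast at htk; linarith))
        simpa using this
  obtain ⟨k, hk⟩ := exists_nat_ge t
  exact key k t ht hk

theorem abs_re_mul_im_sub_le (z w : ℂ) : |z.re * w.im - z.im * w.re| ≤ ‖z‖ * ‖w‖ := by
  have h := Complex.abs_im_le_norm ((starRingEnd ℂ) z * w)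
  rw [norm_mul, Complex.norm_conj] at h
  refine le_of_eq_of_le (congrArg _ ?_) h
  simp [Complex.mul_im]
  ring

theorem HasDerivAt.complex_re {f : ℝ → ℂ} {f' : ℂ} {x : ℝ} (h : HasDerivAt f f' x) :
    HasDerivAt (fun x => (f x).re) f'.re x :=
  Complex.reCLM.hasFDerivAt.comp_hasDerivAt x h

theorem HasDerivAt.complex_im {f : ℝ → ℂ} {f' : ℂ} {x : ℝ} (h : HasDerivAt f f' x) :
    HasDerivAt (fun x => (f x).im) f'.im x :=
  Complex.imCLM.hasFDerivAt.comp_hasDerivAt x h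

namespace IsBoundedModeSystem

variable {a c N : ℝ} {V W Z : ℝ → ℂ}

theorem expBddBot_V_W_Z_add_one (h : IsBoundedModeSystem a c N V W Z) (hc : 1 < c)
    (hca : c < a) {s : ℝ} (hs : -1 < s) (hsL : s + 1 < a + c) (hV : ExpBddBot s V) :
    ExpBddBot (s + 1) V ∧ ExpBddBot (s + 1) W ∧ ExpBddBot (s + 1) Z := by
  have hg := hV.forcing N
  have hW0 : ExpBddBot 0 W := by
    have := ((h.expBddBot_S (by linarith) hc).mono zero_le_one).add
      (h.expBddBot_V.const_mul (1 + c - a : ℝ))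
    simpa using this
  have hZ : ExpBddBot (s + 1) Z := ExpBddBot.of_deriv_of_lt (l := a + c) h.deriv_Z hsL
    (by simpa using hg.const_mul (-(c : ℂ)))
  have hW : ExpBddBot (s + 1) W := ExpBddBot.of_deriv_of_gt (l := c - a) h.deriv_W
    (by linarith) (by linarith) hZ hW0
  refine ⟨?_, hW, hZ⟩
  refine ExpBddBot.of_deriv_of_gt (l := -1) (fun x => (h.deriv_V x).congr_deriv ?_)
    (by linarith) (by norm_num) (hW.sub hg) h.expBddBot_V
  push_cast
  ring

theorem eq_zero_of_lt (h : IsBoundedModeSystem a c N V W Z) (hc : 1 < c) (hca : c < a)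
    (hN : N ≠ 0) (x : ℝ) : V x = 0 := by
  have hstep := fun s hs hsL hV =>
    h.expBddBot_V_W_Z_add_one hc hca (s := s) hs hsL hV
  have hV1 : ExpBddBot (c + a / 2 - 1) V :=
    bootstrap (P := fun s => ExpBddBot s V) (L := a + c) (fun s hs => h.expBddBot_V.mono hs)
      (fun s hs hsL hV => (hstep s hs hsL hV).1) (by linarith)
  obtain ⟨hV, hW, hZ⟩ := hstep _ (by linarith) (by linarith) hV1
  rw [sub_add_cancel] at hV hW hZ
  obtain ⟨CV, hCV0, hCV⟩ := hV.exists_le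
  obtain ⟨CW, hCW0, hCW⟩ := hW.exists_le
  obtain ⟨CZ, hCZ0, hCZ⟩ := hZ.exists_le
  have hZt := h.expBdd_Z (by linarith) hc
  have hWt : ExpBdd 1 W := ExpBdd.of_deriv_of_lt (l := c - a) h.deriv_W (by linarith) hZt
  obtain ⟨DZ, hDZ0, hDZ⟩ := hZt.exists_nonneg
  obtain ⟨DW, hDW0, hDW⟩ := hWt.exists_nonneg
  have hcN : c * N ≠ 0 := mul_ne_zero (by linarith) hN
  set E : ℝ → ℝ := fun x => Real.exp (-(2 * c) * x) *
    (-(Real.exp x / 2 * ((V x).re * (V x).re + (V x).im * (V x).im)) -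
      ((W x).re * (Z x).im - (W x).im * (Z x).re) / (c * N)) with hE
  have hderiv : ∀ x, HasDerivAt E ((c + 1 / 2) * (Real.exp x * Real.exp (-(2 * c) * x)) *
      ((V x).re * (V x).re + (V x).im * (V x).im)) x := by
    intro x
    have hVr := (h.deriv_V x).complex_re
    have hVi := (h.deriv_V x).complex_im
    have hWr := (h.deriv_W x).complex_re
    have hWi := (h.deriv_W x).complex_im
    have hZr := (h.deriv_Z x).complex_re
    have hZi := (h.deriv_Z x).complex_im
    have he := ((hasDerivAt_id x).const_mul (-(2 * c))).exp
    refine (he.mul ((((Real.hasDerivAt_exp x).div_const 2).mul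
      ((hVr.mul hVr).add (hVi.mul hVi))).neg.sub
      (((hWr.mul hZi).sub (hWi.mul hZr)).div_const (c * N)))).congr_deriv ?_
    simp only [id, Complex.add_re, Complex.add_im, Complex.sub_re, Complex.sub_im, Complex.mul_re,
      Complex.mul_im, Complex.neg_re, Complex.neg_im, Complex.I_re, Complex.I_im,
      Complex.ofReal_re, Complex.ofReal_im, Pi.add_apply, Pi.sub_apply, Pi.mul_apply, Pi.neg_apply]
    field_simp
    ring
  have hVe : ∀ x, (V x).re * (V x).re + (V x).im * (V x).im = ‖V x‖ ^ 2 := fun x => by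
    rw [← Complex.normSq_apply, Complex.normSq_eq_norm_sq]
  have hIm : ∀ x, |((W x).re * (Z x).im - (W x).im * (Z x).re) / (c * N)| ≤
      ‖W x‖ * ‖Z x‖ / |c * N| := fun x => by
    rw [abs_div]
    exact div_le_div_of_nonneg_right (abs_re_mul_im_sub_le _ _) (abs_nonneg _)
  have hzero := deriv_eq_zero_of_squeeze (C := DW * DZ / |c * N|)
    (D := CV ^ 2 / 2 + CW * CZ / |c * N|) (s := 2 - 2 * c) (t := a) hderiv
    (fun x => by rw [hVe]; positivity) (by linarith) (by linarith) ?_ ?_ x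
  · rw [hVe] at hzero
    have h1 : (c + 1 / 2) * (Real.exp x * Real.exp (-(2 * c) * x)) ≠ 0 := by positivity
    simpa using (mul_eq_zero.1 hzero).resolve_left h1
  · intro x hx
    have h1 := (neg_le_abs _).trans (hIm x)
    have h2 : ‖W x‖ * ‖Z x‖ ≤ (DW * Real.exp (1 * x)) * (DZ * Real.exp (1 * x)) :=
      mul_le_mul (hDW x hx) (hDZ x hx) (norm_nonneg _) (by positivity)
    have h3 : 0 ≤ Real.exp x / 2 * ‖V x‖ ^ 2 := by positivity
    have h4 : ‖W x‖ * ‖Z x‖ / |c * N| ≤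
        (DW * Real.exp (1 * x)) * (DZ * Real.exp (1 * x)) / |c * N| :=
      div_le_div_of_nonneg_right h2 (abs_nonneg _)
    have h5 : Real.exp ((2 - 2 * c) * x) =
        Real.exp (-(2 * c) * x) * (Real.exp (1 * x) * Real.exp (1 * x)) := by
      rw [← Real.exp_add, ← Real.exp_add]; ring_nf
    simp only [hE, hVe]
    rw [h5]
    calc _ ≤ Real.exp (-(2 * c) * x) *
          ((DW * Real.exp (1 * x)) * (DZ * Real.exp (1 * x)) / |c * N|) :=
          mul_le_mul_of_nonneg_left (by linarith) (Real.exp_pos _).le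
      _ = _ := by ring
  · intro x hx
    have h1 := hIm x
    have h2 : ‖W x‖ * ‖Z x‖ ≤
        (CW * Real.exp ((c + a / 2) * x)) * (CZ * Real.exp ((c + a / 2) * x)) :=
      mul_le_mul (hCW x hx) (hCZ x hx) (norm_nonneg _) (by positivity)
    have h3 : Real.exp x / 2 * ‖V x‖ ^ 2 ≤ 1 / 2 * (CV * Real.exp ((c + a / 2) * x)) ^ 2 := by
      have := hCV x hx
      have := Real.exp_le_one_iff.2 hx
      gcongr
    have h4 : ‖W x‖ * ‖Z x‖ / |c * N| ≤ _ :=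
      div_le_div_of_nonneg_right h2 (abs_nonneg _)
    have h5 : Real.exp (a * x) = Real.exp (-(2 * c) * x) *
        (Real.exp ((c + a / 2) * x) * Real.exp ((c + a / 2) * x)) := by
      rw [← Real.exp_add, ← Real.exp_add]; ring_nf
    have h6 : 0 ≤ Real.exp x / 2 * ‖V x‖ ^ 2 := by positivity
    simp only [hE, hVe]
    rw [h5, abs_mul, abs_of_pos (Real.exp_pos _)]
    calc _ ≤ Real.exp (-(2 * c) * x) * (1 / 2 * (CV * Real.exp ((c + a / 2) * x)) ^ 2 +
          (CW * Real.exp ((c + a / 2) * x)) * (CZ * Real.exp ((c + a / 2) * x)) / |c * N|) := by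
          refine mul_le_mul_of_nonneg_left ((abs_sub _ _).trans ?_) (Real.exp_pos _).le
          rw [abs_neg, abs_of_nonneg h6]
          linarith
      _ = _ := by ring

theorem eq_zero_of_two_mul (h : IsBoundedModeSystem a c N V W Z) (ha : 1 < a)
    (hac : 2 * a = c + 1) (hN : N ^ 2 = 1) (x : ℝ) : V x = 0 := by
  have hc : 1 < c := by linarith
  obtain rfl : c = 2 * a - 1 := by linarith
  set y : ℝ → ℂ := fun x => (W x - (1 + (2 * a - 1) - a : ℝ) * V x) -
    Complex.I * N * (Real.exp x : ℂ) * V x with hy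
  set Y : ℝ → ℂ := fun x => Z x - Complex.I * N * (Real.exp x : ℂ) * V x with hY
  have hVy : ∀ x, HasDerivAt V ((2 * a - 1 - a : ℝ) * V x + y x) x := fun x =>
    (h.deriv_V x).congr_deriv (by simp only [hy]; push_cast; ring)
  have hgd : ∀ x, HasDerivAt (fun x => Complex.I * N * (Real.exp x : ℂ) * V x)
      (Complex.I * N * (Real.exp x : ℂ) * V x +
        Complex.I * N * (Real.exp x : ℂ) * ((2 * a - 1 - a : ℝ) * V x + y x)) x := fun x =>
    (((Real.hasDerivAt_exp x).ofReal_comp.const_mul (Complex.I * N)).mul (hVy x)).congr_deriv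
      (by ring)
  have hyd : ∀ x, HasDerivAt y ((-1 : ℝ) * y x +
      (Y x - Complex.I * N * (Real.exp x : ℂ) * y x)) x := fun x =>
    ((h.deriv_S x).sub (hgd x)).congr_deriv (by simp only [hy, hY]; push_cast; ring)
  have hYd : ∀ x, HasDerivAt Y ((3 * a - 1 : ℝ) * Y x +
      -(Complex.I * N * (Real.exp x : ℂ) * y x)) x := fun x =>
    ((h.deriv_Z x).sub (hgd x)).congr_deriv (by simp only [hY]; push_cast; ring)
  have hy1 : ExpBddBot 1 y :=
    (h.expBddBot_S (by linarith) hc).sub (by simpa using h.expBddBot_V.forcing N)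
  have hYt : ExpBdd 1 Y :=
    (h.expBdd_Z (by linarith) hc).sub (by simpa using h.expBdd_V.forcing N)
  have hstep : ∀ s, -1 < s → s + 1 < 3 * a - 1 → ExpBddBot s y →
      ExpBddBot (s + 1) y ∧ ExpBddBot (s + 1) Y := by
    intro s hs hsL hys
    have hg := hys.forcing N
    have hYs : ExpBddBot (s + 1) Y := ExpBddBot.of_deriv_of_lt hYd hsL
      (by simpa using hg.const_mul (-1))
    exact ⟨ExpBddBot.of_deriv_of_gt hyd (by linarith) (by norm_num) (hYs.sub hg) hy1, hYs⟩
  have hyt : ExpBddBot (3 * a - 3 / 2 - 1) y :=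
    bootstrap (P := fun s => ExpBddBot s y) (L := 3 * a - 1)
      (fun s hs => hy1.mono (by linarith)) (fun s hs hsL h => (hstep s hs hsL h).1) (by linarith)
  obtain ⟨hyb, hYb⟩ := hstep _ (by linarith) (by linarith) hyt
  rw [sub_add_cancel] at hyb hYb
  obtain ⟨Cy, hCy0, hCy⟩ := hyb.exists_le
  obtain ⟨CY, hCY0, hCY⟩ := hYb.exists_le
  obtain ⟨DY, hDY0, hDY⟩ := hYt.exists_nonneg
  have hNabs : |N| = 1 := by
    rcases eq_or_eq_neg_of_sq_eq_sq N 1 (by simpa using hN) with h | h <;> simp [h]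
  set E : ℝ → ℝ := fun x => Real.exp (-(3 * a - 3) * x) *
    (N * (Real.exp (-1 * x) * ((y x).re * (Y x).im - (y x).im * (Y x).re)) -
      1 / 2 * ((y x).re * (y x).re + (y x).im * (y x).im)) with hE
  have hderiv : ∀ x, HasDerivAt E ((3 * a - 3) / 2 * Real.exp (-(3 * a - 3) * x) *
      ((y x).re * (y x).re + (y x).im * (y x).im)) x := by
    intro x
    have hyr := (hyd x).complex_re
    have hyi := (hyd x).complex_im
    have hYr := (hYd x).complex_re
    have hYi := (hYd x).complex_im
    have he := ((hasDerivAt_id x).const_mul (-(3 * a - 3))).exp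
    have he1 := ((hasDerivAt_id x).const_mul (-1)).exp
    have hee : Real.exp (-1 * x) * Real.exp x = 1 := by rw [← Real.exp_add]; simp
    refine (he.mul (((he1.mul ((hyr.mul hYi).sub (hyi.mul hYr))).const_mul N).sub
      (((hyr.mul hyr).add (hyi.mul hyi)).const_mul (1 / 2)))).congr_deriv ?_
    simp only [id, Complex.add_re, Complex.add_im, Complex.sub_re, Complex.sub_im, Complex.mul_re,
      Complex.mul_im, Complex.neg_re, Complex.neg_im, Complex.I_re, Complex.I_im,
      Complex.ofReal_re, Complex.ofReal_im, Pi.add_apply, Pi.sub_apply, Pi.mul_apply]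
    linear_combination (Real.exp (-(3 * a - 3) * x)) *
      ((N * ((y x).re * (Y x).re + (y x).im * (Y x).im) * N
        - ((y x).re * (y x).re + (y x).im * (y x).im) * N ^ 2) * hee) + Real.exp (-(3 * a - 3) * x) *
      ((y x).re * (Y x).re + (y x).im * (Y x).im
        - ((y x).re * (y x).re + (y x).im * (y x).im)) * hN
  have hye : ∀ x, (y x).re * (y x).re + (y x).im * (y x).im = ‖y x‖ ^ 2 := fun x => by
    rw [← Complex.normSq_apply, Complex.normSq_eq_norm_sq]
  have hIm : ∀ x, |N * (Real.exp (-1 * x) * ((y x).re * (Y x).im - (y x).im * (Y x).re))| ≤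
      Real.exp (-1 * x) * (‖y x‖ * ‖Y x‖) := fun x => by
    rw [abs_mul, hNabs, one_mul, abs_mul, abs_of_pos (Real.exp_pos _)]
    exact mul_le_mul_of_nonneg_left (abs_re_mul_im_sub_le _ _) (Real.exp_pos _).le
  have hzero := deriv_eq_zero_of_squeeze (C := DY ^ 2 / 2) (D := Cy * CY + Cy ^ 2 / 2)
    (s := -(3 * a - 3)) (t := 3 * a - 1) hderiv
    (fun x => by
      rw [hye]
      have : 0 ≤ 3 * a - 3 := by linarith
      positivity) (by linarith) (by linarith) ?_ ?_
  · have hy0 : ∀ x, y x = 0 := fun x => by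
      have h0 := hzero x
      rw [hye] at h0
      have h1 : (3 * a - 3) / 2 * Real.exp (-(3 * a - 3) * x) ≠ 0 :=
        mul_ne_zero (by linarith) (Real.exp_pos _).ne'
      simpa using (mul_eq_zero.1 h0).resolve_left h1
    exact eq_zero_of_deriv_of_expBdd (l := 2 * a - 1 - a)
      (fun x => (hVy x).congr_deriv (by rw [hy0, add_zero])) (by linarith) h.expBdd_V x
  · intro x hx
    have h1 := (le_abs_self _).trans (hIm x)
    have h2 : Real.exp (-1 * x) * (‖y x‖ * ‖Y x‖) ≤ ‖y x‖ * DY := by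
      calc _ ≤ Real.exp (-1 * x) * (‖y x‖ * (DY * Real.exp (1 * x))) := by
            gcongr
            exact hDY x hx
        _ = ‖y x‖ * DY * (Real.exp (-1 * x) * Real.exp (1 * x)) := by ring
        _ = _ := by rw [← Real.exp_add]; simp
    simp only [hE, hye]
    rw [mul_comm (DY ^ 2 / 2)]
    refine mul_le_mul_of_nonneg_left ?_ (Real.exp_pos _).le
    nlinarith [sq_nonneg (‖y x‖ - DY)]
  · intro x hx
    have h1 := hIm x
    have h2 : ‖y x‖ * ‖Y x‖ ≤
        (Cy * Real.exp ((3 * a - 3 / 2) * x)) * (CY * Real.exp ((3 * a - 3 / 2) * x)) :=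
      mul_le_mul (hCy x hx) (hCY x hx) (norm_nonneg _) (by positivity)
    have h3 : ‖y x‖ ^ 2 ≤ Real.exp (-1 * x) * (Cy * Real.exp ((3 * a - 3 / 2) * x)) ^ 2 := by
      have h4 : ‖y x‖ ^ 2 ≤ (Cy * Real.exp ((3 * a - 3 / 2) * x)) ^ 2 := by
        gcongr
        exact hCy x hx
      have h5 : 1 ≤ Real.exp (-1 * x) := Real.one_le_exp (by linarith)
      nlinarith [sq_nonneg (Cy * Real.exp ((3 * a - 3 / 2) * x))]
    have h4 := mul_le_mul_of_nonneg_left h2 (Real.exp_pos (-1 * x)).le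
    have h5 : Real.exp ((3 * a - 1) * x) = Real.exp (-(3 * a - 3) * x) * (Real.exp (-1 * x) *
        (Real.exp ((3 * a - 3 / 2) * x) * Real.exp ((3 * a - 3 / 2) * x))) := by
      rw [← Real.exp_add, ← Real.exp_add, ← Real.exp_add]; ring_nf
    simp only [hE, hye]
    rw [h5, abs_mul, abs_of_pos (Real.exp_pos _)]
    calc _ ≤ Real.exp (-(3 * a - 3) * x) * (Real.exp (-1 * x) *
          ((Cy * Real.exp ((3 * a - 3 / 2) * x)) * (CY * Real.exp ((3 * a - 3 / 2) * x))) +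
          1 / 2 * (Real.exp (-1 * x) * (Cy * Real.exp ((3 * a - 3 / 2) * x)) ^ 2)) := by
          refine mul_le_mul_of_nonneg_left ((abs_sub _ _).trans ?_) (Real.exp_pos _).le
          rw [abs_of_nonneg (by positivity : (0 : ℝ) ≤ 1 / 2 * ‖y x‖ ^ 2)]
          linarith
      _ = _ := by ring

end IsBoundedModeSystem

theorem ContDiffOn.dop {f : ℝ → ℂ} (hf : ContDiffOn ℝ (⊤ : ℕ∞) f (Ioi 0)) :
    ContDiffOn ℝ (⊤ : ℕ∞) (Dop f) (Ioi 0) :=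
  Complex.ofRealCLM.contDiff.contDiffOn.mul (hf.deriv_of_isOpen isOpen_Ioi le_rfl)

theorem ContDiffOn.hasDerivAt_comp_exp {f : ℝ → ℂ} (hf : ContDiffOn ℝ (⊤ : ℕ∞) f (Ioi 0))
    (x : ℝ) : HasDerivAt (fun x => f (Real.exp x)) (Dop f (Real.exp x)) x := by
  have h := ((hf.differentiableOn (by simp)).differentiableAt
    (Ioi_mem_nhds (Real.exp_pos x))).hasDerivAt.scomp x (Real.hasDerivAt_exp x)
  exact h.congr_deriv (by simp [Dop])

/-- A bounded smooth solution on `(0,∞)` of the third-order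
Fourier-mode ODE
`(D_β − |n|μ − 2μ + 1)(D_β + |n|μ − 2μ + 1)(D_β + 1 + inβ)v + (2μ−1)inβ v = 0`
vanishes identically. -/
theorem stmt_11 (μ : ℝ) (hμ : 1 < μ) (n : ℤ) (v : ℝ → ℂ)
    (hsmooth : ContDiffOn ℝ (⊤ : ℕ∞) v (Ioi 0))
    (hbdd : ∃ M : ℝ, ∀ β : ℝ, 0 < β → ‖v β‖ ≤ M)
    (heq : ∀ β : ℝ, 0 < β →
      (Dop (fun b =>
          Dop (fun b' => Dop v b' + (1 + Complex.I * (n : ℂ) * (b' : ℂ)) * v b') b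
            + (((|(n : ℝ)| * μ - 2 * μ + 1 : ℝ)) : ℂ) *
              (Dop v b + (1 + Complex.I * (n : ℂ) * (b : ℂ)) * v b)) β
        + ((-(|(n : ℝ)| * μ) - 2 * μ + 1 : ℝ) : ℂ) *
            (Dop (fun b' => Dop v b' + (1 + Complex.I * (n : ℂ) * (b' : ℂ)) * v b') β
              + (((|(n : ℝ)| * μ - 2 * μ + 1 : ℝ)) : ℂ) *
                (Dop v β + (1 + Complex.I * (n : ℂ) * (β : ℂ)) * v β)))
      + ((2 * μ - 1 : ℝ) : ℂ) * Complex.I * (n : ℂ) * (β : ℂ) * v β = 0) :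
    ∀ β : ℝ, 0 < β → v β = 0 := by
  set w : ℝ → ℂ := fun b' => Dop v b' + (1 + Complex.I * (n : ℂ) * (b' : ℂ)) * v b' with hw
  set z : ℝ → ℂ := fun b => Dop w b + (((|(n : ℝ)| * μ - 2 * μ + 1 : ℝ)) : ℂ) * w b with hz
  have hlin : ContDiffOn ℝ (⊤ : ℕ∞) (fun b : ℝ => 1 + Complex.I * (n : ℂ) * (b : ℂ)) (Ioi 0) :=
    contDiffOn_const.add (contDiffOn_const.mul Complex.ofRealCLM.contDiff.contDiffOn)
  have hws : ContDiffOn ℝ (⊤ : ℕ∞) w (Ioi 0) := hsmooth.dop.add (hlin.mul hsmooth)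
  have hzs : ContDiffOn ℝ (⊤ : ℕ∞) z (Ioi 0) := hws.dop.add (contDiffOn_const.mul hws)
  obtain ⟨M, hM⟩ := hbdd
  have hsys : IsBoundedModeSystem (|(n : ℝ)| * μ) (2 * μ - 1) n (fun x => v (Real.exp x))
      (fun x => w (Real.exp x)) (fun x => z (Real.exp x)) := by
    refine ⟨fun x => ?_, fun x => ?_, fun x => ?_, M, fun x => hM _ (Real.exp_pos x)⟩
    · exact (hsmooth.hasDerivAt_comp_exp x).congr_deriv (by simp only [hw]; push_cast; ring)
    · exact (hws.hasDerivAt_comp_exp x).congr_deriv (by simp only [hz]; push_cast; ring)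
    · refine (hzs.hasDerivAt_comp_exp x).congr_deriv ?_
      have h : Dop z (Real.exp x) + ((-(|(n : ℝ)| * μ) - 2 * μ + 1 : ℝ) : ℂ) * z (Real.exp x) +
          ((2 * μ - 1 : ℝ) : ℂ) * Complex.I * (n : ℂ) * ((Real.exp x : ℝ) : ℂ) *
            v (Real.exp x) = 0 := heq _ (Real.exp_pos x)
      push_cast at h ⊢
      linear_combination h
  suffices h : ∀ x, v (Real.exp x) = 0 by
    intro β hβ
    simpa [Real.exp_log hβ] using h (Real.log β)
  have hc : 1 < 2 * μ - 1 := by linarith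
  rcases eq_or_ne n 0 with rfl | hn0
  · exact IsBoundedModeSystem.eq_zero_of_N_eq_zero (by simpa using hsys) hc
  · rcases (Int.one_le_abs hn0).eq_or_lt with h1 | h1
    · have hn1 : |(n : ℝ)| = 1 := by exact_mod_cast h1.symm
      rw [hn1, one_mul] at hsys
      exact hsys.eq_zero_of_two_mul hμ (by ring) (by rw [← sq_abs, hn1, one_pow])
    · have hn2 : (2 : ℝ) ≤ |(n : ℝ)| := by exact_mod_cast h1
      exact hsys.eq_zero_of_lt hc (by nlinarith) (by exact_mod_cast hn0)
end

section
/- Let p(λ) = (λ−λ₁)(λ−λ₂)(λ−λ₃) with real numbers λ₁ > λ₂ ≥ λ₃, and let q be a complex polynomial of degree at most 2. Then there exist three linearly independent smooth solutions v¹, v², v³ : (0,∞) → ℂ of the equation p(D_β)v − q(D_β)(βv) = 0 such that, as β → 0+: v¹(β)/β^{λ₁} → 1, v²(β)/β^{λ₂} → 1, and v³(β)/β^{λ₃} → 1 if λ₂ ≠ λ₃, while v³(β)/(β^{λ₃}log β) → 1 if λ₂ = λ₃. -/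
open Filter Topology Set

/-- the operator `D_β − a` for a complex scalar `a`. -/
noncomputable def Dm (a : ℂ) (w : ℝ → ℂ) (β : ℝ) : ℂ := Dop w β - a * w β

/-- Coefficient triples `(a, b, c)`, standing for the polynomial `a + b L + c L² / 2` in the
logarithm `L`. -/
abbrev LogCoeff := ℂ × ℂ × ℂ

/-- The operator `s + d/dL` on logarithmic coefficients. -/
def shiftDeriv (s : ℂ) (F : LogCoeff) : LogCoeff :=
  (s * F.1 + F.2.1, s * F.2.1 + F.2.2, s * F.2.2)

/-- A right inverse of `shiftDeriv s`, on all triples if `s ≠ 0`, and on the triples with vanishing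
last entry if `s = 0`. -/
noncomputable def shiftSolve (s : ℂ) (F : LogCoeff) : LogCoeff :=
  if s = 0 then (0, F.1, F.2.1) else
    ((F.1 - (F.2.1 - F.2.2 / s) / s) / s, (F.2.1 - F.2.2 / s) / s, F.2.2 / s)

/-- The value of `a + b L + c L² / 2`. -/
noncomputable def logEval (L : ℝ) (F : LogCoeff) : ℂ :=
  F.1 + (L : ℂ) * F.2.1 + (L : ℂ) ^ 2 / 2 * F.2.2

/-- The sequence is the coefficient sequence of an entire function. -/
def EntireCoeff (F : ℕ → LogCoeff) : Prop :=
  ∀ r : ℝ, 0 ≤ r → Summable fun n => r ^ n * ‖F n‖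

/-- The power series with coefficients `F`. -/
noncomputable def coeffSum (F : ℕ → LogCoeff) (β : ℝ) : LogCoeff := ∑' n, β ^ n • F n

/-- The generalized Frobenius series `∑ n, β ^ (lam + n) P_n (log β)`. -/
noncomputable def frobSeries (lam : ℝ) (F : ℕ → LogCoeff) (β : ℝ) : ℂ :=
  ((β ^ lam : ℝ) : ℂ) * logEval (Real.log β) (coeffSum F β)

/-- The action of `D_β - a` on the coefficients of a Frobenius series. -/
def frobDm (lam : ℝ) (a : ℂ) (F : ℕ → LogCoeff) (n : ℕ) : LogCoeff :=
  shiftDeriv ((lam : ℂ) + n - a) (F n)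

/-- The action of multiplication by `β` on the coefficients of a Frobenius series. -/
def frobMul (F : ℕ → LogCoeff) : ℕ → LogCoeff
  | 0 => 0
  | n + 1 => F n

/-- The operator `c2 s² + c1 s + c0` with `s = μ + d/dL`. -/
def quadShift (c0 c1 c2 μ : ℂ) (F : LogCoeff) : LogCoeff :=
  c2 • shiftDeriv μ (shiftDeriv μ F) + c1 • shiftDeriv μ F + c0 • F

/-- The coefficients produced by the Frobenius recursion. -/
noncomputable def frobCoeff (lam lam1 lam2 lam3 : ℝ) (c0 c1 c2 : ℂ) (F₀ : LogCoeff) :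
    ℕ → LogCoeff
  | 0 => F₀
  | n + 1 =>
    shiftSolve ((lam : ℂ) + (n + 1 : ℕ) - lam3) <|
      shiftSolve ((lam : ℂ) + (n + 1 : ℕ) - lam2) <|
        shiftSolve ((lam : ℂ) + (n + 1 : ℕ) - lam1) <|
          quadShift c0 c1 c2 ((lam : ℂ) + (n + 1 : ℕ))
            (frobCoeff lam lam1 lam2 lam3 c0 c1 c2 F₀ n)

theorem shiftDeriv_shiftSolve {s : ℂ} {F : LogCoeff} (h : s = 0 → F.2.2 = 0) :
    shiftDeriv s (shiftSolve s F) = F := by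
  by_cases hs : s = 0
  · ext <;> simp [shiftDeriv, shiftSolve, hs, h hs]
  · ext <;> simp [shiftDeriv, shiftSolve, hs] <;> field_simp <;> ring

theorem norm_shiftDeriv_le (s : ℂ) (F : LogCoeff) : ‖shiftDeriv s F‖ ≤ (‖s‖ + 1) * ‖F‖ := by
  have h1 : ‖F.1‖ ≤ ‖F‖ := norm_fst_le F
  have h2 : ‖F.2.1‖ ≤ ‖F‖ := (norm_fst_le F.2).trans (norm_snd_le F)
  have h3 : ‖F.2.2‖ ≤ ‖F‖ := (norm_snd_le F.2).trans (norm_snd_le F)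
  have key (x y : ℂ) (hx : ‖x‖ ≤ ‖F‖) (hy : ‖y‖ ≤ ‖F‖) :
      ‖s * x + y‖ ≤ (‖s‖ + 1) * ‖F‖ := by
    refine (norm_add_le _ _).trans ?_
    rw [norm_mul]
    nlinarith [mul_le_mul_of_nonneg_left hx (norm_nonneg s)]
  refine norm_prod_le_iff.2 ⟨key _ _ h1 h2, norm_prod_le_iff.2 ⟨key _ _ h2 h3, ?_⟩⟩
  simpa [shiftDeriv] using key F.2.2 0 h3 (by simp)

theorem le_norm_shiftDeriv (s : ℂ) (F : LogCoeff) : (‖s‖ - 1) * ‖F‖ ≤ ‖shiftDeriv s F‖ := by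
  have h : s • F = shiftDeriv s F - shiftDeriv 0 F := by
    ext <;> simp [shiftDeriv]
  have h0 := norm_shiftDeriv_le 0 F
  have h1 := norm_sub_le (shiftDeriv s F) (shiftDeriv 0 F)
  rw [← h, norm_smul] at h1
  simp only [norm_zero, zero_add, one_mul] at h0
  linarith

theorem norm_quadShift_le (c0 c1 c2 μ : ℂ) (F : LogCoeff) :
    ‖quadShift c0 c1 c2 μ F‖ ≤ (‖c2‖ + ‖c1‖ + ‖c0‖) * (‖μ‖ + 1) ^ 2 * ‖F‖ := by
  have h1 := norm_shiftDeriv_le μ F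
  have h2 := norm_shiftDeriv_le μ (shiftDeriv μ F)
  have hμ := norm_nonneg μ
  have h3 : ‖shiftDeriv μ (shiftDeriv μ F)‖ ≤ (‖μ‖ + 1) ^ 2 * ‖F‖ :=
    h2.trans (by rw [pow_two, mul_assoc]; gcongr)
  have h4 : ‖F‖ ≤ (‖μ‖ + 1) ^ 2 * ‖F‖ := by
    nlinarith [norm_nonneg F, mul_nonneg hμ (norm_nonneg F),
      mul_nonneg (mul_nonneg hμ hμ) (norm_nonneg F)]
  have h5 : ‖shiftDeriv μ F‖ ≤ (‖μ‖ + 1) ^ 2 * ‖F‖ := by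
    nlinarith [norm_nonneg F, mul_nonneg hμ (norm_nonneg F),
      mul_nonneg (mul_nonneg hμ hμ) (norm_nonneg F)]
  calc ‖quadShift c0 c1 c2 μ F‖
      ≤ ‖c2‖ * ‖shiftDeriv μ (shiftDeriv μ F)‖ + ‖c1‖ * ‖shiftDeriv μ F‖ + ‖c0‖ * ‖F‖ := by
        simpa only [quadShift, norm_smul] using
          norm_add₃_le (a := c2 • shiftDeriv μ (shiftDeriv μ F)) (b := c1 • shiftDeriv μ F)
            (c := c0 • F)
    _ ≤ ‖c2‖ * ((‖μ‖ + 1) ^ 2 * ‖F‖) + ‖c1‖ * ((‖μ‖ + 1) ^ 2 * ‖F‖)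
          + ‖c0‖ * ((‖μ‖ + 1) ^ 2 * ‖F‖) := by gcongr
    _ = _ := by ring

theorem EntireCoeff.frobMul {F : ℕ → LogCoeff} (hF : EntireCoeff F) :
    EntireCoeff (frobMul F) := fun r hr => by
  rw [← summable_nat_add_iff 1]
  simpa [_root_.frobMul, pow_succ', mul_assoc] using (hF r hr).mul_left r

theorem EntireCoeff.tail {F : ℕ → LogCoeff} (hF : EntireCoeff F) :
    EntireCoeff fun n => F (n + 1) := fun r hr => by
  refine .of_nonneg_of_le (fun n => by positivity) (fun n => ?_)
    ((summable_nat_add_iff 1).2 (hF (r + 1) (by linarith)))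
  have h1 : r ^ n ≤ (r + 1) ^ n := by gcongr; linarith
  have h2 : (r + 1) ^ n ≤ (r + 1) ^ (n + 1) := pow_le_pow_right₀ (by linarith) (by omega)
  gcongr
  exact h1.trans h2

theorem EntireCoeff.of_le {F G : ℕ → LogCoeff} (hF : EntireCoeff F) (C : ℝ)
    (h : ∀ n, ‖G n‖ ≤ C * 2 ^ n * ‖F n‖) : EntireCoeff G := fun r hr => by
  refine .of_nonneg_of_le (fun n => by positivity) (fun n => ?_)
    ((hF (2 * r) (by linarith)).mul_left C)
  calc r ^ n * ‖G n‖ ≤ r ^ n * (C * 2 ^ n * ‖F n‖) := by gcongr; exact h n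
    _ = _ := by rw [mul_pow]; ring

theorem natCast_le_two_pow (n : ℕ) : (n : ℝ) ≤ 2 ^ n := by
  exact_mod_cast Nat.lt_two_pow_self.le

theorem EntireCoeff.frobDm {F : ℕ → LogCoeff} (hF : EntireCoeff F) (lam : ℝ) (a : ℂ) :
    EntireCoeff (frobDm lam a F) := by
  refine hF.of_le (‖(lam : ℂ)‖ + ‖a‖ + 2) fun n => (norm_shiftDeriv_le _ _).trans ?_
  gcongr
  have h1 : ‖(lam : ℂ) + n - a‖ ≤ ‖(lam : ℂ)‖ + n + ‖a‖ :=
    (norm_sub_le _ _).trans (by gcongr; exact (norm_add_le _ _).trans (by simp))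
  have h2 := natCast_le_two_pow n
  have h3 : (1 : ℝ) ≤ 2 ^ n := one_le_pow₀ (by norm_num)
  nlinarith [norm_nonneg (lam : ℂ), norm_nonneg a]

theorem EntireCoeff.summable {F : ℕ → LogCoeff} (hF : EntireCoeff F) (β : ℝ) :
    Summable fun n => β ^ n • F n :=
  .of_norm (by simpa [norm_smul] using hF |β| (abs_nonneg β))

theorem EntireCoeff.natSmul {F : ℕ → LogCoeff} (hF : EntireCoeff F) :
    EntireCoeff fun n => (n : ℝ) • F n :=
  hF.of_le 1 fun n => by
    rw [norm_smul, one_mul]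
    gcongr
    simpa using natCast_le_two_pow n

theorem hasDerivAt_coeffSum {F : ℕ → LogCoeff} (hF : EntireCoeff F) (β : ℝ) :
    HasDerivAt (coeffSum F) (∑' n : ℕ, (n * β ^ (n - 1)) • F n) β := by
  set R : ℝ := |β| + 1 with hR
  have hR1 : 1 ≤ R := by have := abs_nonneg β; linarith
  refine hasDerivAt_tsum_of_isPreconnected
    (g := fun n x => x ^ n • F n) (g' := fun n x => ((n : ℝ) * x ^ (n - 1)) • F n)
    (hF.natSmul R (by linarith)) (t := Metric.ball 0 R)
    Metric.isOpen_ball (convex_ball 0 R).isPreconnected ?_ ?_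
    (y₀ := 0) (by simp; linarith) (hF.summable 0) (by simp [hR])
  · intro n y _
    exact (hasDerivAt_pow n y).smul_const (F n)
  · intro n y hy
    have hy' : |y| ≤ R := by simpa using (mem_ball_zero_iff.1 hy).le
    have h2 : |y| ^ (n - 1) ≤ R ^ n :=
      (pow_le_pow_left₀ (abs_nonneg y) hy' _).trans (pow_le_pow_right₀ hR1 (Nat.sub_le _ _))
    rw [norm_smul, norm_smul, norm_mul, norm_pow, Real.norm_natCast, Real.norm_eq_abs,
      ← mul_assoc, mul_comm (R ^ n)]
    gcongr

theorem smul_tsum_deriv {F : ℕ → LogCoeff} (hF : EntireCoeff F) {β : ℝ} (hβ : β ≠ 0) :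
    β • ∑' n : ℕ, (n * β ^ (n - 1)) • F n = coeffSum (fun n => (n : ℝ) • F n) β := by
  have h (n : ℕ) : (n * β ^ (n - 1)) • F n = β⁻¹ • β ^ n • (n : ℝ) • F n := by
    rcases n with _ | n
    · simp
    · rw [smul_smul, smul_smul]
      congr 1
      simp only [Nat.add_sub_cancel, pow_succ]
      field_simp
  simp_rw [h]
  rw [(hF.natSmul.summable β).tsum_const_smul, smul_smul, mul_inv_cancel₀ hβ, one_smul]
  rfl

/-- `logEval L` as a continuous linear map. -/
noncomputable def logEvalCLM (L : ℝ) : LogCoeff →L[ℂ] ℂ :=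
  ContinuousLinearMap.fst ℂ ℂ (ℂ × ℂ) +
    (L : ℂ) • (ContinuousLinearMap.fst ℂ ℂ ℂ ∘L ContinuousLinearMap.snd ℂ ℂ (ℂ × ℂ)) +
    ((L : ℂ) ^ 2 / 2) • (ContinuousLinearMap.snd ℂ ℂ ℂ ∘L ContinuousLinearMap.snd ℂ ℂ (ℂ × ℂ))

theorem logEvalCLM_apply (L : ℝ) (F : LogCoeff) : logEvalCLM L F = logEval L F := by
  simp [logEvalCLM, logEval]

theorem EntireCoeff.hasSum {F : ℕ → LogCoeff} (hF : EntireCoeff F) (lam β : ℝ) :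
    HasSum (fun n => ((β ^ lam : ℝ) : ℂ) * ((β : ℂ) ^ n * logEvalCLM (Real.log β) (F n)))
      (frobSeries lam F β) := by
  have h := (((hF.summable β).hasSum.mapL (logEvalCLM (Real.log β)))).mul_left
    ((β ^ lam : ℝ) : ℂ)
  rw [logEvalCLM_apply] at h
  refine h.congr_fun fun n => ?_
  have : β ^ n • F n = ((β : ℂ) ^ n) • F n := by
    ext <;> simp
  rw [this, map_smul, smul_eq_mul]

/-- `shiftDeriv s` as a continuous linear map. -/
noncomputable def shiftDerivCLM (s : ℂ) : LogCoeff →L[ℂ] LogCoeff :=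
  s • ContinuousLinearMap.id ℂ LogCoeff +
    ((ContinuousLinearMap.fst ℂ ℂ ℂ ∘L ContinuousLinearMap.snd ℂ ℂ (ℂ × ℂ)).prod
      ((ContinuousLinearMap.snd ℂ ℂ ℂ ∘L ContinuousLinearMap.snd ℂ ℂ (ℂ × ℂ)).prod 0))

theorem shiftDerivCLM_apply (s : ℂ) (F : LogCoeff) : shiftDerivCLM s F = shiftDeriv s F := by
  ext <;> simp [shiftDerivCLM, shiftDeriv]

theorem coeffSum_frobDm {F : ℕ → LogCoeff} (hF : EntireCoeff F) (lam β : ℝ) :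
    coeffSum (frobDm lam 0 F) β =
      shiftDeriv lam (coeffSum F β) + coeffSum (fun n => (n : ℝ) • F n) β := by
  rw [← shiftDerivCLM_apply]
  refine HasSum.tsum_eq ?_
  refine (((hF.summable β).hasSum.mapL (shiftDerivCLM lam)).add
    (hF.natSmul.summable β).hasSum).congr_fun fun n => ?_
  rw [shiftDerivCLM_apply]
  ext <;> simp [shiftDeriv, frobDm] <;> ring

theorem hasDerivAt_frobSeries {F : ℕ → LogCoeff} (hF : EntireCoeff F) (lam : ℝ) {β : ℝ}
    (hβ : 0 < β) :
    HasDerivAt (frobSeries lam F) ((β : ℂ)⁻¹ * frobSeries lam (frobDm lam 0 F) β) β := by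
  have hβ' : (β : ℂ) ≠ 0 := by exact_mod_cast hβ.ne'
  have hS := hasDerivAt_coeffSum hF β
  have hsm := smul_tsum_deriv hF hβ.ne'
  set S' := ∑' n : ℕ, (n * β ^ (n - 1)) • F n
  have hcoef := coeffSum_frobDm hF lam β
  rw [← hsm] at hcoef
  have d1 : HasDerivAt (fun x => (coeffSum F x).1) S'.1 β :=
    (ContinuousLinearMap.fst ℝ ℂ (ℂ × ℂ)).hasFDerivAt.comp_hasDerivAt β hS
  have d23 : HasDerivAt (fun x => (coeffSum F x).2) S'.2 β :=
    (ContinuousLinearMap.snd ℝ ℂ (ℂ × ℂ)).hasFDerivAt.comp_hasDerivAt β hS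
  have d2 : HasDerivAt (fun x => (coeffSum F x).2.1) S'.2.1 β :=
    (ContinuousLinearMap.fst ℝ ℂ ℂ).hasFDerivAt.comp_hasDerivAt β d23
  have d3 : HasDerivAt (fun x => (coeffSum F x).2.2) S'.2.2 β :=
    (ContinuousLinearMap.snd ℝ ℂ ℂ).hasFDerivAt.comp_hasDerivAt β d23
  have dl : HasDerivAt (fun x : ℝ => ((Real.log x : ℝ) : ℂ)) ((β⁻¹ : ℝ) : ℂ) β :=
    (Real.hasDerivAt_log hβ.ne').ofReal_comp
  have dp : HasDerivAt (fun x : ℝ => ((x ^ lam : ℝ) : ℂ)) ((lam * β ^ (lam - 1) : ℝ) : ℂ) β :=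
    (Real.hasDerivAt_rpow_const (Or.inl hβ.ne')).ofReal_comp
  have key := dp.mul ((d1.add (dl.mul d2)).add (((dl.pow 2).div_const 2).mul d3))
  refine key.congr_deriv ?_
  rw [frobSeries, hcoef, Real.rpow_sub_one hβ.ne']
  simp only [logEval, shiftDeriv, Prod.fst_add, Prod.snd_add, Prod.smul_fst, Prod.smul_snd,
    Complex.real_smul, Pi.add_apply, Pi.mul_apply, Pi.pow_apply]
  push_cast
  field_simp
  ring

theorem eqOn_Dop_frobSeries {F : ℕ → LogCoeff} (hF : EntireCoeff F) (lam : ℝ) {w : ℝ → ℂ}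
    (hw : EqOn w (frobSeries lam F) (Ioi 0)) :
    EqOn (Dop w) (frobSeries lam (frobDm lam 0 F)) (Ioi 0) := fun β hβ => by
  have hβ' : (β : ℂ) ≠ 0 := by exact_mod_cast (ne_of_gt hβ)
  have he : w =ᶠ[𝓝 β] frobSeries lam F := hw.eventuallyEq_of_mem (Ioi_mem_nhds hβ)
  rw [Dop, he.deriv_eq, (hasDerivAt_frobSeries hF lam hβ).deriv, mul_inv_cancel_left₀ hβ']

theorem eqOn_Dm_frobSeries {F : ℕ → LogCoeff} (hF : EntireCoeff F) (lam : ℝ) (a : ℂ)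
    {w : ℝ → ℂ} (hw : EqOn w (frobSeries lam F) (Ioi 0)) :
    EqOn (Dm a w) (frobSeries lam (frobDm lam a F)) (Ioi 0) := fun β hβ => by
  rw [Dm, eqOn_Dop_frobSeries hF lam hw hβ, hw hβ]
  refine (((hF.frobDm lam 0).hasSum lam β).sub ((hF.hasSum lam β).mul_left a)).unique ?_
  refine ((hF.frobDm lam a).hasSum lam β).congr_fun fun n => ?_
  have : frobDm lam a F n = frobDm lam 0 F n - a • F n := by
    ext <;> simp [frobDm, shiftDeriv] <;> ring
  rw [this, map_sub, map_smul, smul_eq_mul]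
  ring

theorem eqOn_mul_frobSeries {F : ℕ → LogCoeff} (hF : EntireCoeff F) (lam : ℝ) :
    EqOn (fun β : ℝ => (β : ℂ) * frobSeries lam F β) (frobSeries lam (frobMul F)) (Ioi 0) :=
  fun β _ => by
    refine ((hF.hasSum lam β).mul_left (β : ℂ)).unique ?_
    have h := (hasSum_nat_add_iff' 1).2 (hF.frobMul.hasSum lam β)
    simp only [Finset.range_one, Finset.sum_singleton, frobMul, map_zero, mul_zero,
      sub_zero] at h
    refine h.congr_fun fun n => ?_
    ring

theorem contDiffOn_frobSeries {F : ℕ → LogCoeff} (hF : EntireCoeff F) (lam : ℝ) :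
    ContDiffOn ℝ (⊤ : ℕ∞) (frobSeries lam F) (Ioi 0) := by
  refine contDiffOn_infty.2 fun n => ?_
  induction n generalizing F with
  | zero =>
    exact contDiffOn_zero.2 fun β hβ =>
      (hasDerivAt_frobSeries hF lam hβ).continuousAt.continuousWithinAt
  | succ n ih =>
    push_cast
    refine (contDiffOn_succ_iff_deriv_of_isOpen isOpen_Ioi).2 ⟨fun β hβ =>
      (hasDerivAt_frobSeries hF lam hβ).differentiableAt.differentiableWithinAt, by simp, ?_⟩
    have hinv : ContDiffOn ℝ n (fun β : ℝ => (β : ℂ)⁻¹) (Ioi 0) :=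
      Complex.ofRealCLM.contDiff.contDiffOn.inv fun β hβ => by
        simpa using (ne_of_gt hβ)
    exact (hinv.mul (ih (hF.frobDm lam 0))).congr fun β hβ =>
      (hasDerivAt_frobSeries hF lam hβ).deriv

theorem frobSeries_solves {F : ℕ → LogCoeff} (hF : EntireCoeff F) {lam lam1 lam2 lam3 : ℝ}
    {c0 c1 c2 : ℂ}
    (h0 : shiftDeriv ((lam : ℂ) - lam1) (shiftDeriv ((lam : ℂ) - lam2)
      (shiftDeriv ((lam : ℂ) - lam3) (F 0))) = 0)
    (hrec : ∀ n : ℕ, shiftDeriv ((lam : ℂ) + (n + 1 : ℕ) - lam1)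
      (shiftDeriv ((lam : ℂ) + (n + 1 : ℕ) - lam2)
        (shiftDeriv ((lam : ℂ) + (n + 1 : ℕ) - lam3) (F (n + 1)))) =
      quadShift c0 c1 c2 ((lam : ℂ) + (n + 1 : ℕ)) (F n)) {β : ℝ} (hβ : 0 < β) :
    Dm (lam1 : ℂ) (Dm (lam2 : ℂ) (Dm (lam3 : ℂ) (frobSeries lam F))) β -
      (c2 * Dop (Dop (fun b => (b : ℂ) * frobSeries lam F b)) β +
        c1 * Dop (fun b => (b : ℂ) * frobSeries lam F b) β +
        c0 * ((β : ℂ) * frobSeries lam F β)) = 0 := by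
  have hM := hF.frobMul
  have m0 := eqOn_mul_frobSeries hF lam
  have m1 := eqOn_Dop_frobSeries hM lam m0
  have m2 := eqOn_Dop_frobSeries (hM.frobDm lam 0) lam m1
  have e3 := eqOn_Dm_frobSeries hF lam lam3 fun _ _ => rfl
  have e2 := eqOn_Dm_frobSeries (hF.frobDm lam lam3) lam lam2 e3
  have e1 := eqOn_Dm_frobSeries ((hF.frobDm lam lam3).frobDm lam lam2) lam lam1 e2
  rw [e1 hβ, m2 hβ, m1 hβ, show (β : ℂ) * frobSeries lam F β = _ from m0 hβ]
  refine ((((((hF.frobDm lam lam3).frobDm lam lam2).frobDm lam lam1).hasSum lam β).sub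
    ((((((hM.frobDm lam 0).frobDm lam 0).hasSum lam β).mul_left c2).add
      (((hM.frobDm lam 0).hasSum lam β).mul_left c1)).add
      ((hM.hasSum lam β).mul_left c0)))).unique ?_
  refine (hasSum_zero (α := ℂ) (β := ℕ)).congr_fun fun n => ?_
  have key : frobDm lam lam1 (frobDm lam lam2 (frobDm lam lam3 F)) n =
      c2 • frobDm lam 0 (frobDm lam 0 (frobMul F)) n + c1 • frobDm lam 0 (frobMul F) n +
        c0 • frobMul F n := by
    rcases n with _ | n
    · simpa [frobDm, frobMul, shiftDeriv] using h0
    · simpa only [frobDm, frobMul, quadShift, sub_zero] using hrec n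
  rw [key]
  simp only [map_add, map_smul, smul_eq_mul]
  ring

theorem shiftSolve_last_eq_zero {s : ℂ} (hs : s ≠ 0) {F : LogCoeff} (h : F.2.2 = 0) :
    (shiftSolve s F).2.2 = 0 := by
  simp [shiftSolve, hs, h]

theorem shiftSolve_snd_eq_zero {s : ℂ} (hs : s ≠ 0) {F : LogCoeff} (h : F.2 = 0) :
    (shiftSolve s F).2 = 0 := by
  simp [shiftSolve, hs, h]

theorem shiftSolve_last_eq_zero_of_snd {s : ℂ} {F : LogCoeff} (h : F.2 = 0) :
    (shiftSolve s F).2.2 = 0 := by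
  by_cases hs : s = 0 <;> simp [shiftSolve, hs, h]

theorem quadShift_last_eq_zero {c0 c1 c2 μ : ℂ} {F : LogCoeff} (h : F.2.2 = 0) :
    (quadShift c0 c1 c2 μ F).2.2 = 0 := by
  simp [quadShift, shiftDeriv, h]

theorem quadShift_snd_eq_zero {c0 c1 c2 μ : ℂ} {F : LogCoeff} (h : F.2 = 0) :
    (quadShift c0 c1 c2 μ F).2 = 0 := by
  simp [quadShift, shiftDeriv, h]

theorem shiftSolve_step {lam1 lam2 lam3 μ : ℝ} (h12 : lam2 < lam1) (hμ : lam3 < μ)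
    {F : LogCoeff} (hc : μ ≤ lam1 → F.2.2 = 0) (hb : μ ≤ lam2 → F.2 = 0) :
    let X := shiftSolve ((μ : ℂ) - lam1) F
    let Y := shiftSolve ((μ : ℂ) - lam2) X
    let G := shiftSolve ((μ : ℂ) - lam3) Y
    shiftDeriv ((μ : ℂ) - lam1) (shiftDeriv ((μ : ℂ) - lam2) (shiftDeriv ((μ : ℂ) - lam3) G)) = F ∧
      (μ < lam1 → G.2.2 = 0) ∧ (μ < lam2 → G.2 = 0) := by
  intro X Y G
  have hne {a : ℝ} (h : μ ≠ a) : (μ : ℂ) - a ≠ 0 := sub_ne_zero.2 (by exact_mod_cast h)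
  have heq {a : ℝ} (h : (μ : ℂ) - a = 0) : μ = a := by exact_mod_cast sub_eq_zero.1 h
  have hX : μ ≤ lam2 → X.2 = 0 := fun h =>
    shiftSolve_snd_eq_zero (hne (h.trans_lt h12).ne) (hb h)
  have hG3 := hne hμ.ne'
  refine ⟨?_, fun h => shiftSolve_last_eq_zero hG3 ?_, fun h =>
    shiftSolve_snd_eq_zero hG3 (shiftSolve_snd_eq_zero (hne h.ne) (hX h.le))⟩
  · rw [shiftDeriv_shiftSolve fun h => absurd h hG3,
      shiftDeriv_shiftSolve fun h => by rw [hX (heq h).le]; rfl,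
      shiftDeriv_shiftSolve fun h => hc (heq h).le]
  · by_cases h2 : μ = lam2
    · exact shiftSolve_last_eq_zero_of_snd (hX h2.le)
    · exact shiftSolve_last_eq_zero (hne h2) (shiftSolve_last_eq_zero (hne h.ne) (hc h.le))

theorem half_le_norm_sub_sub_one {μ a : ℝ} (h : 2 * |a| + 2 ≤ μ) : μ / 2 ≤ ‖(μ : ℂ) - a‖ - 1 := by
  rw [← Complex.ofReal_sub, Complex.norm_real, Real.norm_eq_abs]
  have := le_abs_self (μ - a)
  have := le_abs_self a
  linarith

theorem mul_norm_le_of_frobRec {lam1 lam2 lam3 μ : ℝ} {c0 c1 c2 : ℂ} {F G : LogCoeff}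
    (h1 : 2 * |lam1| + 2 ≤ μ) (h2 : 2 * |lam2| + 2 ≤ μ) (h3 : 2 * |lam3| + 2 ≤ μ)
    (h : shiftDeriv ((μ : ℂ) - lam1) (shiftDeriv ((μ : ℂ) - lam2)
      (shiftDeriv ((μ : ℂ) - lam3) G)) = quadShift c0 c1 c2 μ F) :
    μ * ‖G‖ ≤ 32 * (‖c2‖ + ‖c1‖ + ‖c0‖) * ‖F‖ := by
  have hμ : 2 ≤ μ := by linarith [abs_nonneg lam1]
  have step {a : ℝ} (ha : 2 * |a| + 2 ≤ μ) (X : LogCoeff) :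
      μ / 2 * ‖X‖ ≤ ‖shiftDeriv ((μ : ℂ) - a) X‖ :=
    (mul_le_mul_of_nonneg_right (half_le_norm_sub_sub_one ha) (norm_nonneg X)).trans
      (le_norm_shiftDeriv _ X)
  have hq := norm_quadShift_le c0 c1 c2 μ F
  rw [← h, Complex.norm_real, Real.norm_eq_abs, abs_of_nonneg (by linarith)] at hq
  set K := ‖c2‖ + ‖c1‖ + ‖c0‖ with hK
  have hK0 : 0 ≤ K := by positivity
  have hcube : μ / 2 * (μ / 2 * (μ / 2 * ‖G‖)) ≤ K * (2 * μ) ^ 2 * ‖F‖ := by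
    calc _ ≤ μ / 2 * (μ / 2 * ‖shiftDeriv ((μ : ℂ) - lam3) G‖) := by gcongr; exact step h3 _
      _ ≤ μ / 2 * ‖shiftDeriv ((μ : ℂ) - lam2) (shiftDeriv ((μ : ℂ) - lam3) G)‖ := by
        gcongr; exact step h2 _
      _ ≤ _ := step h1 _
      _ ≤ K * (μ + 1) ^ 2 * ‖F‖ := hq
      _ ≤ _ := by gcongr; linarith
  have hsq : 0 < μ ^ 2 := by positivity
  refine le_of_mul_le_mul_left ?_ hsq
  linarith

theorem entireCoeff_of_frobRec {F : ℕ → LogCoeff} {lam lam1 lam2 lam3 : ℝ} {c0 c1 c2 : ℂ}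
    (hrec : ∀ n : ℕ, shiftDeriv ((lam : ℂ) + (n + 1 : ℕ) - lam1)
      (shiftDeriv ((lam : ℂ) + (n + 1 : ℕ) - lam2)
        (shiftDeriv ((lam : ℂ) + (n + 1 : ℕ) - lam3) (F (n + 1)))) =
      quadShift c0 c1 c2 ((lam : ℂ) + (n + 1 : ℕ)) (F n)) : EntireCoeff F := fun r hr => by
  set K := ‖c2‖ + ‖c1‖ + ‖c0‖ with hK
  have hK0 : 0 ≤ K := by positivity
  have ht : Tendsto (fun n : ℕ => lam + ((n + 1 : ℕ) : ℝ)) atTop atTop :=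
    tendsto_atTop_add_const_left _ _ ((tendsto_natCast_atTop_atTop).comp (tendsto_add_atTop_nat 1))
  refine summable_of_ratio_norm_eventually_le (r := 1 / 2) (by norm_num) ?_
  filter_upwards [ht.eventually_ge_atTop (2 * |lam1| + 2), ht.eventually_ge_atTop (2 * |lam2| + 2),
    ht.eventually_ge_atTop (2 * |lam3| + 2), ht.eventually_ge_atTop (64 * (K + 1) * r)]
    with n h1 h2 h3 h4
  have hn := mul_norm_le_of_frobRec (F := F n) (G := F (n + 1)) (c0 := c0) (c1 := c1) (c2 := c2)
    h1 h2 h3 (by simpa using hrec n)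
  have hG : r * ‖F (n + 1)‖ ≤ 1 / 2 * ‖F n‖ := by
    have h5 := mul_le_mul_of_nonneg_right h4 (norm_nonneg (F (n + 1)))
    have h6 : 64 * (K + 1) * (r * ‖F (n + 1)‖) ≤ 64 * (K + 1) * (1 / 2 * ‖F n‖) := by
      nlinarith [norm_nonneg (F n)]
    exact le_of_mul_le_mul_left h6 (by positivity)
  rw [Real.norm_of_nonneg (by positivity), Real.norm_of_nonneg (by positivity), pow_succ]
  calc r ^ n * r * ‖F (n + 1)‖ = r ^ n * (r * ‖F (n + 1)‖) := by ring
    _ ≤ r ^ n * (1 / 2 * ‖F n‖) := by gcongr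
    _ = _ := by ring

theorem exists_frobSeries {lam lam1 lam2 lam3 : ℝ} (h12 : lam2 < lam1) (h3 : lam3 ≤ lam)
    (c0 c1 c2 : ℂ) (F₀ : LogCoeff)
    (h0 : shiftDeriv ((lam : ℂ) - lam1) (shiftDeriv ((lam : ℂ) - lam2)
      (shiftDeriv ((lam : ℂ) - lam3) F₀)) = 0)
    (hc : lam < lam1 → F₀.2.2 = 0) (hb : lam < lam2 → F₀.2 = 0) :
    ∃ F : ℕ → LogCoeff, F 0 = F₀ ∧ EntireCoeff F ∧ ∀ β : ℝ, 0 < β →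
      Dm (lam1 : ℂ) (Dm (lam2 : ℂ) (Dm (lam3 : ℂ) (frobSeries lam F))) β -
        (c2 * Dop (Dop (fun b => (b : ℂ) * frobSeries lam F b)) β +
          c1 * Dop (fun b => (b : ℂ) * frobSeries lam F b) β +
          c0 * ((β : ℂ) * frobSeries lam F β)) = 0 := by
  set F := frobCoeff lam lam1 lam2 lam3 c0 c1 c2 F₀ with hF
  have step (n : ℕ) (hc' : lam + n < lam1 → (F n).2.2 = 0) (hb' : lam + n < lam2 → (F n).2 = 0) :=
    shiftSolve_step (lam3 := lam3) (μ := lam + (n + 1 : ℕ)) (F := quadShift c0 c1 c2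
      ((lam : ℂ) + (n + 1 : ℕ)) (F n)) h12
      (h3.trans_lt (by push_cast; linarith [n.cast_nonneg (α := ℝ)]))
      (fun h => quadShift_last_eq_zero (hc' (by push_cast at h; linarith)))
      (fun h => quadShift_snd_eq_zero (hb' (by push_cast at h; linarith)))
  have inv (n : ℕ) : (lam + n < lam1 → (F n).2.2 = 0) ∧ (lam + n < lam2 → (F n).2 = 0) := by
    induction n with
    | zero => simpa [hF, frobCoeff] using ⟨hc, hb⟩
    | succ n ih => simpa [hF, frobCoeff] using (step n ih.1 ih.2).2
  have hrec (n : ℕ) := by simpa using (step n (inv n).1 (inv n).2).1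
  have hrec' : ∀ n : ℕ, shiftDeriv ((lam : ℂ) + (n + 1 : ℕ) - lam1)
      (shiftDeriv ((lam : ℂ) + (n + 1 : ℕ) - lam2)
        (shiftDeriv ((lam : ℂ) + (n + 1 : ℕ) - lam3) (F (n + 1)))) =
      quadShift c0 c1 c2 ((lam : ℂ) + (n + 1 : ℕ)) (F n) := fun n => by
    simpa [hF, frobCoeff] using hrec n
  have hE := entireCoeff_of_frobRec hrec'
  exact ⟨F, rfl, hE, fun β hβ => frobSeries_solves hE h0 hrec' hβ⟩

theorem coeffSum_eq_add {F : ℕ → LogCoeff} (hF : EntireCoeff F) (β : ℝ) :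
    coeffSum F β = F 0 + β • coeffSum (fun n => F (n + 1)) β := by
  have h := (hF.summable β).tsum_eq_zero_add
  rw [coeffSum, h, coeffSum, ← (hF.tail.summable β).tsum_const_smul]
  simp [pow_succ', smul_smul]

theorem tendsto_logEval_smul {T : ℝ → LogCoeff} (hT : ContinuousAt T 0) :
    Tendsto (fun β : ℝ => logEval (Real.log β) (β • T β)) (𝓝[>] 0) (𝓝 0) := by
  have hT' : Tendsto T (𝓝[>] 0) (𝓝 (T 0)) := hT.mono_left nhdsWithin_le_nhds
  have t1 := (continuous_fst.tendsto _).comp hT'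
  have t23 := (continuous_snd.tendsto _).comp hT'
  have t2 := (continuous_fst.tendsto _).comp t23
  have t3 := (continuous_snd.tendsto _).comp t23
  have b0 : Tendsto (fun β : ℝ => (β : ℂ)) (𝓝[>] 0) (𝓝 0) :=
    (Complex.continuous_ofReal.tendsto' 0 0 Complex.ofReal_zero).mono_left nhdsWithin_le_nhds
  have l1 : Tendsto (fun β : ℝ => ((Real.log β * β ^ (1 : ℝ) : ℝ) : ℂ)) (𝓝[>] 0) (𝓝 0) :=
    (Complex.continuous_ofReal.tendsto' 0 0 Complex.ofReal_zero).comp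
      (tendsto_log_mul_rpow_nhdsGT_zero one_pos)
  have l2 : Tendsto (fun β : ℝ => ((Real.log β * β ^ (1 / 2 : ℝ) : ℝ) : ℂ)) (𝓝[>] 0) (𝓝 0) :=
    (Complex.continuous_ofReal.tendsto' 0 0 Complex.ofReal_zero).comp
      (tendsto_log_mul_rpow_nhdsGT_zero one_half_pos)
  have key := ((b0.mul t1).add (l1.mul t2)).add (((l2.pow 2).div_const 2).mul t3)
  simp only [zero_mul, add_zero, ne_eq, OfNat.ofNat_ne_zero, not_false_eq_true, zero_pow,
    zero_div] at key
  refine key.congr' ?_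
  filter_upwards [self_mem_nhdsWithin] with β hβ
  have hs : (((β ^ (1 / 2 : ℝ) : ℝ) : ℂ)) ^ 2 = β := by
    rw [← Complex.ofReal_pow, ← Real.rpow_natCast, ← Real.rpow_mul (le_of_lt hβ)]
    norm_num
  simp only [logEval, Function.comp, Prod.smul_fst, Prod.smul_snd, Complex.real_smul,
    Real.rpow_one, Complex.ofReal_mul, mul_pow, hs]
  ring

theorem frobSeries_div {F : ℕ → LogCoeff} (hF : EntireCoeff F) (lam : ℝ) {β : ℝ} (hβ : 0 < β) :
    frobSeries lam F β / ((β ^ lam : ℝ) : ℂ) =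
      logEval (Real.log β) (F 0) +
        logEval (Real.log β) (β • coeffSum (fun n => F (n + 1)) β) := by
  have : ((β ^ lam : ℝ) : ℂ) ≠ 0 := by exact_mod_cast (Real.rpow_pos_of_pos hβ lam).ne'
  rw [frobSeries, mul_div_cancel_left₀ _ this, coeffSum_eq_add hF]
  simp only [← logEvalCLM_apply, map_add]

theorem tendsto_frobSeries_div {F : ℕ → LogCoeff} (hF : EntireCoeff F) (lam : ℝ)
    (h0 : F 0 = (1, 0, 0)) :
    Tendsto (fun β : ℝ => frobSeries lam F β / ((β ^ lam : ℝ) : ℂ)) (𝓝[>] 0) (𝓝 1) := by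
  have h := (tendsto_logEval_smul (hasDerivAt_coeffSum hF.tail 0).continuousAt).const_add 1
  rw [add_zero] at h
  refine h.congr' ?_
  filter_upwards [self_mem_nhdsWithin] with β hβ
  simp [frobSeries_div hF lam hβ, h0, logEval]

theorem tendsto_inv_log : Tendsto (fun β : ℝ => ((Real.log β : ℝ) : ℂ)⁻¹) (𝓝[>] 0) (𝓝 0) := by
  have h := (Complex.continuous_ofReal.tendsto' 0 0 Complex.ofReal_zero).comp
    (tendsto_inv_atBot_zero.comp Real.tendsto_log_nhdsGT_zero)
  simpa [Function.comp_def] using h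

theorem eventually_log_ne_zero : ∀ᶠ β : ℝ in 𝓝[>] 0, ((Real.log β : ℝ) : ℂ) ≠ 0 := by
  filter_upwards [Real.tendsto_log_nhdsGT_zero.eventually_lt_atBot 0] with β hβ
  exact_mod_cast hβ.ne

theorem tendsto_frobSeries_div_log {F : ℕ → LogCoeff} (hF : EntireCoeff F) (lam : ℝ)
    (h0 : F 0 = (0, 1, 0)) :
    Tendsto (fun β : ℝ => frobSeries lam F β / (((β ^ lam : ℝ) : ℂ) * ((Real.log β : ℝ) : ℂ)))
      (𝓝[>] 0) (𝓝 1) := by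
  have h := ((tendsto_logEval_smul (hasDerivAt_coeffSum hF.tail 0).continuousAt).mul
    tendsto_inv_log).const_add 1
  rw [mul_zero, add_zero] at h
  refine h.congr' ?_
  filter_upwards [self_mem_nhdsWithin, eventually_log_ne_zero] with β hβ hl
  rw [← div_div, frobSeries_div hF lam hβ, h0, add_div]
  simp [logEval, hl, div_eq_mul_inv]

/-- Functions of pairwise different orders of magnitude are linearly independent. -/
theorem eq_zero_of_tendsto_div {α : Type*} {l : Filter α} [l.NeBot] {v1 v2 v3 g1 g2 g3 : α → ℂ}
    (h1 : Tendsto (fun x => v1 x / g1 x) l (𝓝 1)) (h2 : Tendsto (fun x => v2 x / g2 x) l (𝓝 1))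
    (h3 : Tendsto (fun x => v3 x / g3 x) l (𝓝 1)) (h12 : Tendsto (fun x => g1 x / g2 x) l (𝓝 0))
    (h23 : Tendsto (fun x => g2 x / g3 x) l (𝓝 0)) (hg1 : ∀ᶠ x in l, g1 x ≠ 0)
    (hg2 : ∀ᶠ x in l, g2 x ≠ 0) {a b c : ℂ}
    (h : ∀ᶠ x in l, a * v1 x + b * v2 x + c * v3 x = 0) : a = 0 ∧ b = 0 ∧ c = 0 := by
  have hc : c = 0 := by
    have t := ((((h1.mul h12).mul h23).const_mul a).add ((h2.mul h23).const_mul b)).add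
      (h3.const_mul c)
    have e : Tendsto (fun _ : α => (0 : ℂ)) l (𝓝 c) := by
      simp only [mul_zero, mul_one, zero_add] at t
      refine t.congr' ?_
      filter_upwards [h, hg1, hg2] with x hx hx1 hx2
      rw [div_mul_div_cancel₀ hx1, div_mul_div_cancel₀ hx2, div_mul_div_cancel₀ hx2,
        ← zero_div (g3 x), ← hx]
      ring
    exact tendsto_nhds_unique e tendsto_const_nhds
  subst hc
  have hb : b = 0 := by
    have t := ((h1.mul h12).const_mul a).add (h2.const_mul b)
    have e : Tendsto (fun _ : α => (0 : ℂ)) l (𝓝 b) := by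
      simp only [mul_zero, mul_one, zero_add] at t
      refine t.congr' ?_
      filter_upwards [h, hg1] with x hx hx1
      rw [div_mul_div_cancel₀ hx1, ← zero_div (g2 x), ← hx]
      ring
    exact tendsto_nhds_unique e tendsto_const_nhds
  subst hb
  refine ⟨?_, rfl, rfl⟩
  have e : Tendsto (fun _ : α => (0 : ℂ)) l (𝓝 (a * 1)) := by
    refine (h1.const_mul a).congr' ?_
    filter_upwards [h] with x hx
    rw [← mul_div_assoc, show a * v1 x = 0 by simpa using hx, zero_div]
  simpa using tendsto_nhds_unique e tendsto_const_nhds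

theorem eventually_rpow_ne_zero (a : ℝ) : ∀ᶠ β : ℝ in 𝓝[>] 0, ((β ^ a : ℝ) : ℂ) ≠ 0 := by
  filter_upwards [self_mem_nhdsWithin] with β hβ
  exact_mod_cast (Real.rpow_pos_of_pos hβ a).ne'

theorem tendsto_rpow_div_rpow {a b : ℝ} (h : b < a) :
    Tendsto (fun β : ℝ => ((β ^ a : ℝ) : ℂ) / ((β ^ b : ℝ) : ℂ)) (𝓝[>] 0) (𝓝 0) := by
  have h1 : Tendsto (fun β : ℝ => ((β ^ (a - b) : ℝ) : ℂ)) (𝓝[>] 0) (𝓝 0) :=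
    (Complex.continuous_ofReal.tendsto' 0 0 Complex.ofReal_zero).comp
      (((Real.continuousAt_rpow_const 0 (a - b) (Or.inr (by linarith))).tendsto.mono_left
        nhdsWithin_le_nhds).trans (by rw [Real.zero_rpow (by linarith)]))
  refine h1.congr' ?_
  filter_upwards [self_mem_nhdsWithin] with β hβ
  rw [Real.rpow_sub hβ, Complex.ofReal_div]

/-- Frobenius fundamental system: for `p(λ)=(λ−λ₁)(λ−λ₂)(λ−λ₃)` with
`λ₁ > λ₂ ≥ λ₃` and `q` of degree `≤ 2` (coefficients `c₀, c₁, c₂`), the equation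
`p(D_β)v − q(D_β)(βv) = 0` has three linearly independent solutions with prescribed
asymptotics `β^{λ₁}`, `β^{λ₂}`, and `β^{λ₃}` (resp. `β^{λ₃} log β` when `λ₂ = λ₃`)
as `β → 0+`. -/
theorem stmt_12 (lam1 lam2 lam3 : ℝ) (h12 : lam2 < lam1) (h23 : lam3 ≤ lam2)
    (c0 c1 c2 : ℂ) :
    ∃ v1 v2 v3 : ℝ → ℂ,
      (ContDiffOn ℝ (⊤ : ℕ∞) v1 (Ioi 0) ∧ ContDiffOn ℝ (⊤ : ℕ∞) v2 (Ioi 0) ∧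
        ContDiffOn ℝ (⊤ : ℕ∞) v3 (Ioi 0)) ∧
      (∀ v ∈ ({v1, v2, v3} : Set (ℝ → ℂ)), ∀ β : ℝ, 0 < β →
        Dm (lam1 : ℂ) (Dm (lam2 : ℂ) (Dm (lam3 : ℂ) v)) β -
          (c2 * Dop (Dop (fun b => (b : ℂ) * v b)) β +
            c1 * Dop (fun b => (b : ℂ) * v b) β + c0 * ((β : ℂ) * v β)) = 0) ∧
      (∀ a b c : ℂ, (∀ β : ℝ, 0 < β → a * v1 β + b * v2 β + c * v3 β = 0) →
        a = 0 ∧ b = 0 ∧ c = 0) ∧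
      Tendsto (fun β : ℝ => v1 β / ((β ^ lam1 : ℝ) : ℂ)) (nhdsWithin 0 (Ioi 0)) (nhds 1) ∧
      Tendsto (fun β : ℝ => v2 β / ((β ^ lam2 : ℝ) : ℂ)) (nhdsWithin 0 (Ioi 0)) (nhds 1) ∧
      (lam2 ≠ lam3 →
        Tendsto (fun β : ℝ => v3 β / ((β ^ lam3 : ℝ) : ℂ)) (nhdsWithin 0 (Ioi 0)) (nhds 1)) ∧
      (lam2 = lam3 →
        Tendsto (fun β : ℝ => v3 β / (((β ^ lam3 : ℝ) : ℂ) * ((Real.log β : ℝ) : ℂ)))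
          (nhdsWithin 0 (Ioi 0)) (nhds 1)) := by
  obtain ⟨F1, h10, hE1, hs1⟩ := exists_frobSeries (lam := lam1) (lam3 := lam3) h12
    (h23.trans h12.le) c0 c1 c2 (1, 0, 0) (by simp [shiftDeriv]) (by simp) (by simp)
  obtain ⟨F2, h20, hE2, hs2⟩ := exists_frobSeries (lam := lam2) h12 h23 c0 c1 c2 (1, 0, 0)
    (by simp [shiftDeriv]) (by simp) (by simp)
  have t1 := tendsto_frobSeries_div hE1 lam1 h10
  have t2 := tendsto_frobSeries_div hE2 lam2 h20
  have g12 := tendsto_rpow_div_rpow h12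
  have n1 := eventually_rpow_ne_zero lam1
  have n2 := eventually_rpow_ne_zero lam2
  by_cases h : lam2 = lam3
  · obtain ⟨F3, h30, hE3, hs3⟩ := exists_frobSeries (lam := lam3) h12 le_rfl c0 c1 c2 (0, 1, 0)
      (by simp [shiftDeriv, h]) (by simp) (by simp [h])
    have t3 := tendsto_frobSeries_div_log hE3 lam3 h30
    have g23 : Tendsto (fun β : ℝ => ((β ^ lam2 : ℝ) : ℂ) /
        (((β ^ lam3 : ℝ) : ℂ) * ((Real.log β : ℝ) : ℂ))) (𝓝[>] 0) (𝓝 0) := by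
      refine tendsto_inv_log.congr' ?_
      filter_upwards [n2] with β hβ
      rw [← h, ← div_div, div_self hβ, one_div]
    refine ⟨_, _, _, ⟨contDiffOn_frobSeries hE1 lam1, contDiffOn_frobSeries hE2 lam2,
      contDiffOn_frobSeries hE3 lam3⟩, ?_, fun a b c habc => eq_zero_of_tendsto_div t1 t2 t3 g12
        g23 n1 n2 (by filter_upwards [self_mem_nhdsWithin] with β hβ using habc β hβ),
      t1, t2, fun h' => absurd h h', fun _ => t3⟩
    rintro v (rfl | rfl | rfl)
    exacts [hs1, hs2, hs3]
  · obtain ⟨F3, h30, hE3, hs3⟩ := exists_frobSeries (lam := lam3) h12 le_rfl c0 c1 c2 (1, 0, 0)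
      (by simp [shiftDeriv]) (by simp) (by simp)
    have t3 := tendsto_frobSeries_div hE3 lam3 h30
    have g23 := tendsto_rpow_div_rpow (lt_of_le_of_ne h23 (Ne.symm h))
    refine ⟨_, _, _, ⟨contDiffOn_frobSeries hE1 lam1, contDiffOn_frobSeries hE2 lam2,
      contDiffOn_frobSeries hE3 lam3⟩, ?_, fun a b c habc => eq_zero_of_tendsto_div t1 t2 t3 g12
        g23 n1 n2 (by filter_upwards [self_mem_nhdsWithin] with β hβ using habc β hβ),
      t1, t2, fun _ => t3, fun h' => absurd h' h⟩
    rintro v (rfl | rfl | rfl)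
    exacts [hs1, hs2, hs3]
end

section
/- The averaging operator (D_β+1)^{−1} satisfies: (i) for every f ∈ 𝒞, (D_β+1)^{−1}f ∈ 𝒞 with ‖(D_β+1)^{−1}f‖_sup ≤ ‖f‖_sup and lim_{β→∞}(D_β+1)^{−1}f(β) = f(∞); (ii) there is a constant C = C(δ) such that for every f ∈ 𝒞^δ, (D_β+1)^{−1}f ∈ 𝒞^δ and ‖(D_β+1)^{−1}f‖_{𝒞^δ} ≤ C‖f‖_{𝒞^δ}; in particular (D_β+1)^{−1} maps 𝒞^δ_0 into 𝒞^δ_0. -/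
open Filter Topology Set MeasureTheory intervalIntegral

/-- sup norm over `[0,∞)`. -/
noncomputable def supN (f : ℝ → ℂ) : ℝ := ⨆ β : Ici (0 : ℝ), ‖f (β : ℝ)‖

/-- weighted seminorm `sup_{β>0} β^δ ‖f(β) − L‖`. -/
noncomputable def hoel (δ : ℝ) (f : ℝ → ℂ) (L : ℂ) : ℝ :=
  ⨆ β : Ioi (0 : ℝ), (β : ℝ) ^ δ * ‖f (β : ℝ) - L‖

/-- the `𝒞^δ` norm, with `L = f(∞)`. -/
noncomputable def normC (δ : ℝ) (f : ℝ → ℂ) (L : ℂ) : ℝ := supN f + hoel δ f L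

/-- membership in `𝒞^δ`, with limit value `L` at infinity. -/
def MemCdelta (δ : ℝ) (f : ℝ → ℂ) (L : ℂ) : Prop :=
  ContinuousOn f (Ici 0) ∧ Tendsto f atTop (nhds L) ∧
    BddAbove (Set.range fun β : Ioi (0 : ℝ) => (β : ℝ) ^ δ * ‖f (β : ℝ) - L‖)

/-- the averaging operator `(D_β+1)^{-1} f (β) = β^{-1} ∫_0^β f(b) db`,
extended by `f(0)` at `β = 0`. -/
noncomputable def Avg (f : ℝ → ℂ) (β : ℝ) : ℂ :=
  if β = 0 then f 0 else ((β⁻¹ : ℝ) : ℂ) * ∫ b in (0 : ℝ)..β, f b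

lemma bddAbove_norm_of_tendsto {f : ℝ → ℂ} {L : ℂ} (hf : ContinuousOn f (Ici 0))
    (hL : Tendsto f atTop (𝓝 L)) :
    BddAbove (Set.range fun β : Ici (0 : ℝ) => ‖f (β : ℝ)‖) := by
  obtain ⟨R, hR⟩ := eventually_atTop.1
    (hL.norm.eventually (gt_mem_nhds (lt_add_one ‖L‖)))
  obtain ⟨K, hK⟩ := (isCompact_Icc (a := (0 : ℝ)) (b := R)).exists_bound_of_continuousOn
    (hf.mono Icc_subset_Ici_self)
  refine ⟨max K (‖L‖ + 1), ?_⟩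
  rintro _ ⟨⟨β, hβ⟩, rfl⟩
  rcases le_total β R with h | h
  · exact (hK β ⟨hβ, h⟩).trans (le_max_left _ _)
  · exact (hR β h).le.trans (le_max_right _ _)

lemma norm_le_supN {f : ℝ → ℂ} {L : ℂ} (hf : ContinuousOn f (Ici 0))
    (hL : Tendsto f atTop (𝓝 L)) {β : ℝ} (hβ : 0 ≤ β) : ‖f β‖ ≤ supN f :=
  le_ciSup (bddAbove_norm_of_tendsto hf hL) ⟨β, hβ⟩

lemma Avg_eq_integral (f : ℝ → ℂ) (β : ℝ) :
    Avg f β = ∫ s in (0 : ℝ)..1, f (β * s) := by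
  rcases eq_or_ne β 0 with rfl | h
  · simp [Avg]
  · rw [Avg, if_neg h, intervalIntegral.integral_comp_mul_left f h]
    simp

lemma continuous_comp_max {f : ℝ → ℂ} (hf : ContinuousOn f (Ici 0)) :
    Continuous fun x : ℝ => f (max x 0) :=
  hf.comp_continuous (by fun_prop) fun _ => mem_Ici.2 (le_max_right _ _)

lemma intervalIntegrable_comp_mul {f : ℝ → ℂ} (hf : ContinuousOn f (Ici 0)) {β : ℝ}
    (hβ : 0 ≤ β) : IntervalIntegrable (fun s => f (β * s)) volume 0 1 := by
  apply ContinuousOn.intervalIntegrable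
  rw [uIcc_of_le zero_le_one]
  exact hf.comp (by fun_prop) fun s hs => mul_nonneg hβ hs.1

lemma continuousOn_Avg {f : ℝ → ℂ} (hf : ContinuousOn f (Ici 0)) :
    ContinuousOn (Avg f) (Ici 0) := by
  have hc : Continuous fun β : ℝ => ∫ s in (0 : ℝ)..1, f (max (β * s) 0) :=
    continuous_parametric_intervalIntegral_of_continuous'
      (f := fun β s : ℝ => f (max (β * s) 0))
      ((continuous_comp_max hf).comp continuous_mul) 0 1
  refine hc.continuousOn.congr fun β hβ => ?_
  rw [Avg_eq_integral]
  refine integral_congr fun s hs => ?_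
  rw [uIcc_of_le zero_le_one] at hs
  simp only [max_eq_left (mul_nonneg (mem_Ici.1 hβ) hs.1)]

lemma supN_Avg_le {f : ℝ → ℂ} {L : ℂ} (hf : ContinuousOn f (Ici 0))
    (hL : Tendsto f atTop (𝓝 L)) : supN (Avg f) ≤ supN f := by
  refine ciSup_le fun ⟨β, hβ⟩ => ?_
  rw [Avg_eq_integral]
  have := norm_integral_le_of_norm_le_const (a := 0) (b := 1) (C := supN f)
    (f := fun s => f (β * s)) fun s hs => by
      rw [uIoc_of_le zero_le_one] at hs
      exact norm_le_supN hf hL (mul_nonneg hβ hs.1.le)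
  simpa using this

lemma tendsto_Avg {f : ℝ → ℂ} {L : ℂ} (hf : ContinuousOn f (Ici 0))
    (hL : Tendsto f atTop (𝓝 L)) : Tendsto (Avg f) atTop (𝓝 L) := by
  have key : Tendsto (fun β : ℝ => ∫ s in (0 : ℝ)..1, f (β * s)) atTop
      (𝓝 (∫ _ in (0 : ℝ)..1, L)) := by
    refine tendsto_integral_filter_of_dominated_convergence (fun _ => supN f) ?_ ?_ ?_ ?_
    · filter_upwards [eventually_ge_atTop 0] with β hβ
      rw [uIoc_of_le zero_le_one]
      exact (intervalIntegrable_comp_mul hf hβ).1.aestronglyMeasurable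
    · filter_upwards [eventually_ge_atTop 0] with β hβ
      refine ae_of_all _ fun s hs => ?_
      rw [uIoc_of_le zero_le_one] at hs
      exact norm_le_supN hf hL (mul_nonneg hβ hs.1.le)
    · exact intervalIntegrable_const
    · refine ae_of_all _ fun s hs => ?_
      rw [uIoc_of_le zero_le_one] at hs
      exact hL.comp (tendsto_id.atTop_mul_const hs.1)
  simpa [← Avg_eq_integral] using key

lemma hoel_nonneg (δ : ℝ) (f : ℝ → ℂ) (L : ℂ) : 0 ≤ hoel δ f L :=
  Real.iSup_nonneg fun β => mul_nonneg (Real.rpow_nonneg (mem_Ioi.1 β.2).le _) (norm_nonneg _)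

lemma supN_nonneg (f : ℝ → ℂ) : 0 ≤ supN f :=
  Real.iSup_nonneg fun _ => norm_nonneg _

lemma rpow_mul_norm_Avg_sub_le {δ : ℝ} (hδ : δ < 1) {f : ℝ → ℂ} {L : ℂ}
    (hf : MemCdelta δ f L) {β : ℝ} (hβ : 0 < β) :
    β ^ δ * ‖Avg f β - L‖ ≤ (1 - δ)⁻¹ * hoel δ f L := by
  obtain ⟨hc, -, hb⟩ := hf
  have hsub : Avg f β - L = ∫ s in (0 : ℝ)..1, (f (β * s) - L) := by
    rw [integral_sub (intervalIntegrable_comp_mul hc hβ.le) intervalIntegrable_const,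
      Avg_eq_integral]
    simp
  have hpt : ∀ x : ℝ, 0 < x → ‖f x - L‖ ≤ hoel δ f L * x ^ (-δ) := fun x hx => by
    have h : x ^ δ * ‖f x - L‖ ≤ hoel δ f L := le_ciSup hb ⟨x, hx⟩
    rw [Real.rpow_neg hx.le, ← div_eq_mul_inv, le_div_iff₀ (Real.rpow_pos_of_pos hx _)]
    linarith
  have hint : IntervalIntegrable (fun s : ℝ => hoel δ f L * β ^ (-δ) * s ^ (-δ)) volume 0 1 :=
    (intervalIntegrable_rpow' (by linarith)).const_mul _
  have hle : ‖∫ s in (0 : ℝ)..1, (f (β * s) - L)‖ ≤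
      ∫ s in (0 : ℝ)..1, hoel δ f L * β ^ (-δ) * s ^ (-δ) := by
    refine norm_integral_le_of_norm_le zero_le_one (ae_of_all _ fun s hs => ?_) hint
    refine (hpt _ (mul_pos hβ hs.1)).trans_eq ?_
    rw [Real.mul_rpow hβ.le hs.1.le, mul_assoc]
  have hval : ∫ s in (0 : ℝ)..1, s ^ (-δ) = (1 - δ)⁻¹ := by
    rw [integral_rpow (Or.inl (by linarith)), Real.one_rpow, Real.zero_rpow (by linarith),
      sub_zero, one_div, neg_add_eq_sub]
  rw [intervalIntegral.integral_const_mul, hval, ← hsub] at hle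
  calc β ^ δ * ‖Avg f β - L‖
      ≤ β ^ δ * (hoel δ f L * β ^ (-δ) * (1 - δ)⁻¹) := by gcongr
    _ = (β ^ δ * β ^ (-δ)) * ((1 - δ)⁻¹ * hoel δ f L) := by ring
    _ = (1 - δ)⁻¹ * hoel δ f L := by
      rw [← Real.rpow_add hβ, add_neg_cancel, Real.rpow_zero, one_mul]

/-- `(D_β+1)^{-1}` is bounded on `𝒞`, `𝒞^δ` and `𝒞^δ_0`. -/
theorem stmt_14 (μ δ : ℝ) (hμ : 1 < μ)
    (hδ0 : 0 < δ)
    (hδ1 : δ < min (Real.sqrt (4 * μ ^ 2 - 2 * μ + 1) - 2 * μ + 1) 1) :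
    (∀ (f : ℝ → ℂ) (L : ℂ), ContinuousOn f (Ici 0) → Tendsto f atTop (nhds L) →
      ContinuousOn (Avg f) (Ici 0) ∧ supN (Avg f) ≤ supN f ∧
      Tendsto (Avg f) atTop (nhds L)) ∧
    (∃ C : ℝ, 0 < C ∧ ∀ (f : ℝ → ℂ) (L : ℂ), MemCdelta δ f L →
      MemCdelta δ (Avg f) L ∧ normC δ (Avg f) L ≤ C * normC δ f L) := by
  have hδ : δ < 1 := hδ1.trans_le (min_le_right _ _)
  refine ⟨fun f L hf hL => ⟨continuousOn_Avg hf, supN_Avg_le hf hL, tendsto_Avg hf hL⟩,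
    (1 - δ)⁻¹, inv_pos.2 (by linarith), fun f L hf => ?_⟩
  have hbound : ∀ β : Ioi (0 : ℝ),
      (β : ℝ) ^ δ * ‖Avg f (β : ℝ) - L‖ ≤ (1 - δ)⁻¹ * hoel δ f L :=
    fun β => rpow_mul_norm_Avg_sub_le hδ hf β.2
  refine ⟨⟨continuousOn_Avg hf.1, tendsto_Avg hf.1 hf.2.1, _, forall_mem_range.2 hbound⟩, ?_⟩
  have hone : 1 ≤ (1 - δ)⁻¹ := (one_le_inv₀ (by linarith)).2 (by linarith)
  have hhoel : hoel δ (Avg f) L ≤ (1 - δ)⁻¹ * hoel δ f L :=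
    Real.iSup_le hbound (mul_nonneg (by linarith) (hoel_nonneg δ f L))
  have hsup : supN (Avg f) ≤ (1 - δ)⁻¹ * supN f :=
    (supN_Avg_le hf.1 hf.2.1).trans (le_mul_of_one_le_left (supN_nonneg f) hone)
  rw [normC, normC, mul_add]
  exact add_le_add hsup hhoel
end
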